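/- Let R → S be a local homomorphism of complete Noetherian local domains of positive prime characteristic p. If T is a seed over R, then T ⊗_R S is a seed over S. Consequently, for every big Cohen-Macaulay R-algebra B there exists a balanced big Cohen-Macaulay S-algebra C together with a ring homomorphism B → C such that the square with R → S, R → B, S → C commutes. -/

import Mathlib

open IsLocalRing

universe u v w

/-- `x` is a system of parameters of the local ring `R`: a sequence of `dim R` elements
of the maximal ideal generating an ideal primary to the maximal ideal. -/
def IsSOP (R : Type*) [CommRing R] [IsLocalRing R] {n : ℕ} (x : Fin n → R) : Prop :=
  (n : WithBot ℕ∞) = ringKrullDim R ∧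
  (∀ i, x i ∈ maximalIdeal R) ∧
  (Ideal.span (Set.range x)).radical = maximalIdeal R

/-- The sequence `x` of elements of `R` is a regular sequence on the `R`-module `M`. -/
def IsRegSeq (R : Type*) [CommRing R] (M : Type*) [AddCommGroup M] [Module R M]
    {n : ℕ} (x : Fin n → R) : Prop :=
  RingTheory.Sequence.IsRegular M (List.ofFn x)

/-- `B` is a big Cohen-Macaulay algebra over the local ring `R`: some system of
parameters of `R` is a regular sequence on `B` (and in particular `mB ≠ B`). -/
def IsBigCM (R : Type*) [CommRing R] [IsLocalRing R]
    (B : Type*) [CommRing B] [Algebra R B] : Prop :=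
  (∃ (n : ℕ) (x : Fin n → R), IsSOP R x ∧ IsRegSeq R B x) ∧
  (maximalIdeal R).map (algebraMap R B) ≠ ⊤

/-- `B` is a balanced big Cohen-Macaulay algebra over the local ring `R`: every system of
parameters of `R` is a regular sequence on `B` (and in particular `mB ≠ B`). -/
def IsBalancedBigCM (R : Type*) [CommRing R] [IsLocalRing R]
    (B : Type*) [CommRing B] [Algebra R B] : Prop :=
  (∀ (n : ℕ) (x : Fin n → R), IsSOP R x → IsRegSeq R B x) ∧
  (maximalIdeal R).map (algebraMap R B) ≠ ⊤

/-- `S` is a seed over the local ring `R`: `S` admits an `R`-algebra homomorphism to some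
big Cohen-Macaulay `R`-algebra. -/
def IsSeed (R : Type u) [CommRing R] [IsLocalRing R]
    (S : Type v) [CommRing S] [Algebra R S] : Prop :=
  ∃ (B : Type (max u v)) (_ : CommRing B) (_ : Algebra R B),
    IsBigCM R B ∧ Nonempty (S →ₐ[R] B)

open TensorProduct

open Polynomial in
theorem exists_section_of_sq_zero {E k : Type*} [CommRing E] [Field k] (p : ℕ) [Fact p.Prime]
    [CharP E p] [CharP k p] (π : E →+* k) (hπ : Function.Surjective π)
    (hsq : ∀ x y, π x = 0 → π y = 0 → x * y = 0) :
    ∃ s : k →+* E, π.comp s = RingHom.id k := by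
  have hp : p.Prime := Fact.out
  have : Nontrivial E := CharP.nontrivial_of_char_ne_one hp.ne_one
  have hpow : ∀ x, π x = 0 → x ^ p = 0 := fun x hx ↦ by
    rw [← Nat.sub_add_cancel hp.two_le, pow_add, sq, hsq x x hx hx, mul_zero]
  let 𝒮 : Set (Subring E) := {A | (∀ b, b ^ p ∈ A) ∧ ∀ x ∈ A, π x = 0 → x = 0}
  have h0 : (frobenius E p).range ∈ 𝒮 := by
    refine ⟨fun b ↦ ⟨b, rfl⟩, ?_⟩
    rintro _ ⟨b, rfl⟩ hb
    rw [frobenius_def, map_pow] at hb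
    exact hpow b (eq_zero_of_pow_eq_zero hb)
  obtain ⟨A, -, ⟨hA1, hA2⟩, hAmax⟩ := zorn_le_nonempty₀ 𝒮 (by
    intro c hc hchain y hy
    refine ⟨sSup c, ⟨fun b ↦ ?_, fun x hx hx0 ↦ ?_⟩, fun z hz ↦ le_sSup hz⟩
    · exact (le_sSup hy : y ≤ sSup c) ((hc hy).1 b)
    · rw [Subring.mem_sSup_of_directedOn ⟨y, hy⟩ hchain.directedOn] at hx
      obtain ⟨s, hs, hxs⟩ := hx
      exact (hc hs).2 x hxs hx0) _ h0
  let K : Subfield k :=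
    { (A.map π) with
      inv_mem' := by
        rintro _ ⟨e, he, rfl⟩
        by_cases h : π e = 0
        · rw [h, inv_zero]
          exact (A.map π).zero_mem
        obtain ⟨e', he'⟩ := hπ (π e)⁻¹
        refine ⟨e ^ (p - 1) * e' ^ p, A.mul_mem (A.pow_mem he _) (hA1 _), ?_⟩
        rw [map_mul, map_pow, map_pow, he', inv_pow]
        obtain ⟨q, rfl⟩ : ∃ q, p = q + 1 := ⟨p - 1, by have := hp.pos; omega⟩
        simp only [Nat.add_sub_cancel]
        field_simp
        exact (pow_succ _ _).symm }
  have hKmem : ∀ a, a ∈ K ↔ ∃ e ∈ A, π e = a := fun a ↦ Iff.rfl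
  have hsurj : ∀ a : k, ∃ e ∈ A, π e = a := by
    intro a
    by_contra hna
    obtain ⟨b, hb⟩ := hπ a
    let A' : Subring E := (aeval (R := A) b).range.toSubring
    have hAA' : A ≤ A' := fun e he ↦ ⟨C ⟨e, he⟩, by simp; rfl⟩
    have hbA' : b ∈ A' := ⟨X, by simp⟩
    have hA' : A' ∈ 𝒮 := by
      refine ⟨fun e ↦ hAA' (hA1 e), ?_⟩
      rintro _ ⟨q, rfl⟩ hq
      let c : A := ⟨b ^ p, hA1 b⟩
      have hmon : (X ^ p - C c).Monic := monic_X_pow_sub_C c hp.ne_zero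
      have hroot : aeval b (X ^ p - C c) = 0 := by
        simp only [map_sub, map_pow, aeval_X, aeval_C]
        exact sub_self _
      have hqr : aeval b q = aeval b (q %ₘ (X ^ p - C c)) := by
        conv_lhs => rw [← modByMonic_add_div q (X ^ p - C c)]
        rw [map_add, map_mul, hroot, zero_mul, add_zero]
      set r := q %ₘ (X ^ p - C c) with hr
      let σ : A →+* K := (π.comp A.subtype).codRestrict K fun e ↦ ⟨e, e.2, rfl⟩
      have hirr : Irreducible (X ^ p - C (⟨a ^ p, ⟨b ^ p, hA1 b, by simp [hb]⟩⟩ : K)) := by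
        apply X_pow_sub_C_irreducible_of_prime hp
        intro z hz
        have hz' : (z : k) ^ p = a ^ p := congrArg Subtype.val hz
        have : (z : k) = a := frobenius_inj k p hz'
        exact hna ((hKmem a).1 (this ▸ z.2))
      have hmin := minpoly.eq_of_irreducible_of_monic (x := a) hirr
        (by simp [Algebra.algebraMap_eq_smul_one, Subfield.smul_def])
        (monic_X_pow_sub_C _ hp.ne_zero)
      have hra : aeval a (r.map σ) = 0 := by
        have h1 : π (aeval b r) = 0 := by rw [← hqr]; exact hq
        rw [aeval_def, hom_eval₂, hb] at h1
        rw [aeval_def, eval₂_map]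
        exact h1
      have hr0 : r.map σ = 0 := by
        by_contra hne
        have h1 := minpoly.degree_le_of_ne_zero K a hne hra
        rw [← hmin, degree_X_pow_sub_C hp.pos] at h1
        have h2 : r.degree < p := by
          have := degree_modByMonic_lt q hmon
          rwa [degree_X_pow_sub_C hp.pos] at this
        exact absurd (h1.trans (degree_map_le)) (not_le.2 h2)
      have hσ : Function.Injective σ := by
        rw [injective_iff_map_eq_zero]
        intro e he
        exact Subtype.ext (hA2 e e.2 (congrArg Subtype.val he))
      rw [Polynomial.map_eq_zero_iff hσ] at hr0
      change aeval b q = 0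
      rw [hqr, hr0, map_zero]
    exact hna ⟨b, hAmax hA' hAA' hbA', hb⟩
  let e : A ≃+* k := RingEquiv.ofBijective (π.comp A.subtype)
    ⟨(injective_iff_map_eq_zero _).2 fun e he ↦ Subtype.ext (hA2 e e.2 he),
      fun a ↦ by obtain ⟨e, he, h⟩ := hsurj a; exact ⟨⟨e, he⟩, h⟩⟩
  exact ⟨A.subtype.comp e.symm.toRingHom, RingHom.ext fun a ↦ e.apply_symm_apply a⟩

theorem formallySmooth_zmod (p : ℕ) [Fact p.Prime] (k : Type*) [Field k] [Algebra (ZMod p) k] :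
    Algebra.FormallySmooth (ZMod p) k := by
  refine Algebra.FormallySmooth.of_comp_surjective fun B _ _ I hI f ↦ ?_
  rcases subsingleton_or_nontrivial B with hB | hB
  · exact ⟨default, Subsingleton.elim _ _⟩
  have hI' : I ≠ ⊤ := by
    rintro rfl
    rw [Ideal.top_pow] at hI
    exact top_ne_bot hI
  have : Nontrivial (B ⧸ I) := Ideal.Quotient.nontrivial_iff.2 hI'
  have hfi : Function.Injective f := f.toRingHom.injective
  let E : Subalgebra (ZMod p) B := f.range.comap (Ideal.Quotient.mkₐ _ I)
  let g : k ≃ₐ[ZMod p] f.range := AlgEquiv.ofInjective f hfi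
  let π : E →ₐ[ZMod p] k := g.symm.toAlgHom.comp
    (((Ideal.Quotient.mkₐ (ZMod p) I).comp E.val).codRestrict f.range fun x ↦ x.2)
  have hπ : ∀ x : E, f (π x) = Ideal.Quotient.mk I x := fun x ↦
    congrArg Subtype.val (g.apply_symm_apply _)
  have : CharP E p := charP_of_injective_algebraMap (algebraMap (ZMod p) E).injective p
  have : CharP k p := charP_of_injective_algebraMap (algebraMap (ZMod p) k).injective p
  obtain ⟨s, hs⟩ := exists_section_of_sq_zero p π.toRingHom (by
    intro a
    obtain ⟨b, hb⟩ := Ideal.Quotient.mk_surjective (f a)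
    refine ⟨⟨b, ⟨a, hb.symm⟩⟩, hfi ?_⟩
    exact (hπ _).trans hb) (by
    intro x y hx hy
    have h : ∀ x : E, π x = 0 → (x : B) ∈ I := fun x hx ↦ by
      rw [← Ideal.Quotient.eq_zero_iff_mem, ← hπ, hx, map_zero]
    apply Subtype.ext
    have := Ideal.mul_mem_mul (h x hx) (h y hy)
    rwa [← sq, hI] at this)
  let s' : k →+* B := E.val.toRingHom.comp s
  refine ⟨{ s' with commutes' := fun r ↦ ?_ }, ?_⟩
  · exact RingHom.congr_fun (RingHom.ext_zmod (s'.comp (algebraMap _ _)) (algebraMap _ _)) r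
  · ext a
    have := hπ (s a)
    have h2 : π (s a) = a := RingHom.congr_fun hs a
    rw [h2] at this
    exact this.symm

theorem exists_coefficient_field (p : ℕ) [Fact p.Prime] (S : Type*) [CommRing S] [IsLocalRing S]
    [IsAdicComplete (maximalIdeal S) S] [CharP S p] :
    ∃ s : ResidueField S →+* S, (residue S).comp s = RingHom.id _ := by
  let := ZMod.algebra S p
  have := formallySmooth_zmod p (ResidueField S)
  obtain ⟨g, hg⟩ := Algebra.FormallySmooth.exists_mkₐ_comp_eq_of_isAdicComplete
    (I := maximalIdeal S) (AlgHom.id (ZMod p) (ResidueField S))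
  exact ⟨g, RingHom.ext fun a ↦ AlgHom.congr_fun hg a⟩

namespace MvPowerSeries

theorem mem_span_X_pow_iff {σ k : Type*} [CommRing k] (s : Finset σ) (a : σ → ℕ)
    (h : MvPowerSeries σ k) :
    h ∈ Ideal.span ((fun i ↦ (X i : MvPowerSeries σ k) ^ a i) '' s) ↔
      ∀ α : σ →₀ ℕ, (∀ i ∈ s, α i < a i) → coeff α h = 0 := by
  classical
  constructor
  · intro hh
    induction hh using Submodule.span_induction with
    | mem x hx =>
      obtain ⟨i, hi, rfl⟩ := hx
      intro α hα
      exact X_pow_dvd_iff.1 dvd_rfl α (hα i hi)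
    | zero => simp
    | add x y _ _ hx hy => intro α hα; rw [map_add, hx α hα, hy α hα, add_zero]
    | smul b x _ hx =>
      intro α hα
      rw [smul_eq_mul, coeff_mul]
      refine Finset.sum_eq_zero fun p hp ↦ ?_
      rw [hx p.2 fun i hi ↦ lt_of_le_of_lt ?_ (hα i hi), mul_zero]
      rw [← Finset.HasAntidiagonal.mem_antidiagonal.1 hp]
      simp
  · induction s using Finset.induction_on generalizing h with
    | empty =>
      intro hα
      have : h = 0 := ext fun α ↦ hα α (by simp)
      rw [this]; exact zero_mem _
    | insert i s hi ih =>
      intro hα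
      let h1 : MvPowerSeries σ k := fun α ↦ if α i < a i then coeff α h else 0
      have hc1 : ∀ α, coeff α h1 = if α i < a i then coeff α h else 0 := fun α ↦ rfl
      have h2 : X i ^ a i ∣ h - h1 := X_pow_dvd_iff.2 fun α hαi ↦ by
        rw [map_sub, hc1, if_pos hαi, sub_self]
      have h3 := ih h1 fun α hs ↦ by
        rw [hc1]
        split_ifs with hai
        · exact hα α fun j hj ↦ by
            rcases Finset.mem_insert.1 hj with rfl | hj
            exacts [hai, hs j hj]
        · rfl
      rw [← sub_add_cancel h h1]
      refine add_mem ?_ (Ideal.span_mono (Set.image_mono (by simp)) h3)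
      exact Ideal.mem_of_dvd _ h2 (Ideal.subset_span ⟨i, by simp, rfl⟩)

theorem mem_span_range_X_pow_iff {σ k : Type*} [Fintype σ] [CommRing k] (N : ℕ)
    (h : MvPowerSeries σ k) :
    h ∈ Ideal.span (Set.range fun i ↦ (X i : MvPowerSeries σ k) ^ N) ↔
      ∀ α : σ →₀ ℕ, (∀ i, α i < N) → coeff α h = 0 := by
  simpa using mem_span_X_pow_iff Finset.univ (fun _ ↦ N) h

theorem exists_polynomial_sub_mem {σ k : Type*} [Fintype σ] [CommRing k] (N : ℕ)
    (h : MvPowerSeries σ k) :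
    ∃ P : MvPolynomial σ k,
      h - P ∈ Ideal.span (Set.range fun i ↦ (X i : MvPowerSeries σ k) ^ N) := by
  refine ⟨truncTotal (Fintype.card σ * N + 1) h, (mem_span_range_X_pow_iff _ _).2 fun α hα ↦ ?_⟩
  rw [map_sub, MvPolynomial.coeff_coe, coeff_truncTotal, sub_self]
  rw [Finsupp.degree_eq_sum, Nat.lt_succ_iff]
  calc ∑ i, α i ≤ ∑ _i : σ, N := Finset.sum_le_sum fun i _ ↦ (hα i).le
    _ = _ := by simp

theorem ringHom_ext_of_isHausdorff {σ k S : Type*} [Fintype σ] [CommRing k] [CommRing S]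
    (I : Ideal S) [IsHausdorff I S] {f g : MvPowerSeries σ k →+* S}
    (hC : ∀ a, f (C a) = g (C a)) (hX : ∀ i, f (X i) = g (X i)) (hI : ∀ i, f (X i) ∈ I) :
    f = g := by
  ext h
  rw [← sub_eq_zero]
  refine IsHausdorff.haus ‹_› _ fun N ↦ ?_
  rw [SModEq.zero, smul_eq_mul, Ideal.mul_top]
  obtain ⟨P, hP⟩ := exists_polynomial_sub_mem N h
  have hfg : f.comp MvPolynomial.coeToMvPowerSeries.ringHom =
      g.comp MvPolynomial.coeToMvPowerSeries.ringHom := by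
    refine MvPolynomial.ringHom_ext (fun a ↦ ?_) fun i ↦ ?_
    · simpa using hC a
    · simpa using hX i
  have hP' : f P = g P := RingHom.congr_fun hfg P
  have key : ∀ f : MvPowerSeries σ k →+* S, (∀ i, f (X i) ∈ I) → f (h - P) ∈ I ^ N := by
    intro f hf
    have := Ideal.mem_map_of_mem f hP
    refine (?_ : Ideal.map f _ ≤ I ^ N) this
    rw [Ideal.map_span, Ideal.span_le]
    rintro _ ⟨_, ⟨i, rfl⟩, rfl⟩
    simpa using Ideal.pow_mem_pow (hf i) N
  have := sub_mem (key f hI) (key g fun i ↦ hX i ▸ hI i)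
  rwa [map_sub, map_sub, hP', sub_sub_sub_cancel_right] at this

theorem exists_evalHom {σ k S : Type*} [Fintype σ] [CommRing k] [CommRing S]
    (I : Ideal S) [IsAdicComplete I S] (φ : k →+* S) (x : σ → S) (hx : ∀ i, x i ∈ I) :
    ∃ g : MvPowerSeries σ k →+* S, (∀ a, g (C a) = φ a) ∧ ∀ i, g (X i) = x i := by
  let J := MvPolynomial.idealOfVars σ k
  let e : MvPolynomial σ k →+* S := MvPolynomial.eval₂Hom φ x
  have he : ∀ N, J ^ N ≤ (I ^ N).comap e := fun N ↦ by
    rw [← Ideal.map_le_iff_le_comap, Ideal.map_pow]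
    refine Ideal.pow_right_mono ?_ N
    simp only [J, Ideal.map_span, Ideal.span_le]
    rintro _ ⟨_, ⟨i, rfl⟩, rfl⟩
    simpa [e] using hx i
  let f (N : ℕ) : MvPowerSeries σ k →+* S ⧸ I ^ N :=
    (Ideal.quotientMap (I ^ N) e (he N)).comp (truncTotalAlgHom σ k N).toRingHom
  have hf : ∀ {m n : ℕ} (hle : m ≤ n), (Ideal.Quotient.factorPow I hle).comp (f n) = f m := by
    intro m n hle
    ext h
    have h1 := he m (truncTotal_sub_truncTotal_mem_pow_idealOfVars hle le_rfl h)
    rw [Ideal.mem_comap, map_sub, ← Ideal.Quotient.mk_eq_mk_iff_sub_mem] at h1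
    exact h1
  have hfp : ∀ P : MvPolynomial σ k, IsAdicComplete.liftRingHom I f hf P = e P := by
    intro P
    rw [← sub_eq_zero]
    refine IsHausdorff.haus (I := I) inferInstance _ fun N ↦ ?_
    rw [SModEq.zero, smul_eq_mul, Ideal.mul_top, ← Ideal.Quotient.mk_eq_mk_iff_sub_mem,
      IsAdicComplete.mk_liftRingHom]
    have := congrArg (Ideal.quotientMap (I ^ N) e (he N)) ((truncTotalAlgHom σ k N).commutes P)
    exact this
  refine ⟨IsAdicComplete.liftRingHom I f hf, fun a ↦ ?_, fun i ↦ ?_⟩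
  · simpa [e] using hfp (MvPolynomial.C a)
  · simpa [e] using hfp (MvPolynomial.X i)

end MvPowerSeries

theorem Submodule.mem_smul_top_pi_iff {A : Type*} [CommRing A] (I : Ideal A) {ι : Type*}
    [Fintype ι] (f : ι → A) : f ∈ (I • ⊤ : Submodule A (ι → A)) ↔ ∀ i, f i ∈ I := by
  classical
  constructor
  · intro h i
    have h2 : Submodule.map (LinearMap.proj i : (ι → A) →ₗ[A] A) (I • ⊤) ≤ I := by
      rw [Submodule.map_smul'']
      exact (Submodule.smul_mono le_rfl le_top).trans (by simp)
    exact h2 ⟨f, h, rfl⟩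
  · intro h
    rw [pi_eq_sum_univ' f]
    exact sum_mem fun i _ ↦ Submodule.smul_mem_smul (h i) trivial

theorem isPrecomplete_pi {A : Type*} [CommRing A] (I : Ideal A) [IsPrecomplete I A] {ι : Type*}
    [Fintype ι] : IsPrecomplete I (ι → A) := by
  refine ⟨fun f hf ↦ ?_⟩
  have h : ∀ i, ∃ L : A, ∀ n, f n i ≡ L [SMOD (I ^ n • ⊤ : Submodule A A)] := fun i ↦ by
    refine IsPrecomplete.prec inferInstance fun {m n} hmn ↦ ?_
    have := hf hmn
    rw [SModEq.sub_mem, Submodule.mem_smul_top_pi_iff] at this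
    rw [SModEq.sub_mem, smul_eq_mul, Ideal.mul_top]
    exact this i
  choose L hL using h
  refine ⟨L, fun n ↦ ?_⟩
  rw [SModEq.sub_mem, Submodule.mem_smul_top_pi_iff]
  intro i
  have := hL i n
  rwa [SModEq.sub_mem, smul_eq_mul, Ideal.mul_top] at this

theorem Module.Finite.of_isPrecomplete_of_isHausdorff {A M : Type*} [CommRing A] [AddCommGroup M]
    [Module A M] (I : Ideal A) [IsPrecomplete I A] [IsHausdorff I M]
    [Module.Finite A (M ⧸ (I • ⊤ : Submodule A M))] : Module.Finite A M := by
  obtain ⟨r, f, hf⟩ := Module.Finite.exists_fin' A (M ⧸ (I • ⊤ : Submodule A M))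
  have := isPrecomplete_pi I (ι := Fin r)
  obtain ⟨g, hg⟩ := Module.projective_lifting_property (Submodule.mkQ _) f
    (Submodule.mkQ_surjective (I • ⊤ : Submodule A M))
  have : Function.Surjective g := surjective_of_mkQ_comp_surjective (I := I) (by rwa [hg])
  exact Module.Finite.of_surjective g this

theorem IsHausdorff.of_le {A M : Type*} [CommRing A] [AddCommGroup M] [Module A M] {I J : Ideal A}
    (h : I ≤ J) [IsHausdorff J M] : IsHausdorff I M :=
  ⟨fun x hx ↦ IsHausdorff.haus (I := J) inferInstance x fun n ↦ by
    have := hx n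
    rw [SModEq.zero] at this ⊢
    exact Submodule.smul_mono_left (Ideal.pow_right_mono h n) this⟩

namespace MvPowerSeries

theorem finite_of_isSOP {k S : Type*} [Field k] [CommRing S] [IsLocalRing S] [IsNoetherianRing S]
    [IsHausdorff (maximalIdeal S) S] {n : ℕ} (g : MvPowerSeries (Fin n) k →+* S)
    (hk : Function.Surjective fun a ↦ residue S (g (C a)))
    (hx : (Ideal.span (Set.range fun i ↦ g (X i))).radical = maximalIdeal S) : g.Finite := by
  algebraize [g]
  let J : Ideal (MvPowerSeries (Fin n) k) := Ideal.span (Set.range X)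
  have hJ : J.map (algebraMap _ S) = Ideal.span (Set.range fun i ↦ g (X i)) := by
    rw [Ideal.map_span, ← Set.range_comp]; rfl
  have hle : J.map (algebraMap _ S) ≤ maximalIdeal S := by
    rw [hJ, ← hx]; exact Ideal.le_radical
  have : IsHausdorff J S :=
    IsHausdorff.map_algebraMap_iff.mp (IsHausdorff.of_le hle)
  let 𝔞 := J.map (algebraMap (MvPowerSeries (Fin n) k) S)
  have hsurj : Function.Surjective (algebraMap (MvPowerSeries (Fin n) k) (ResidueField S)) :=
    fun y ↦ by obtain ⟨a, ha⟩ := hk y; exact ⟨C a, ha⟩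
  have : Module.Finite (MvPowerSeries (Fin n) k) (ResidueField S) :=
    Module.Finite.of_surjective (Algebra.linearMap _ _) hsurj
  let π : (S ⧸ 𝔞) →ₐ[MvPowerSeries (Fin n) k] ResidueField S :=
    Ideal.Quotient.factorₐ _ hle
  have hfin : Module.Finite (MvPowerSeries (Fin n) k) (S ⧸ 𝔞) := by
    refine Module.finite_of_surjective_of_ker_le_nilradical π
      (Ideal.Quotient.factor_surjective hle) ?_ (IsNoetherian.noetherian _)
    intro y hy
    obtain ⟨s, rfl⟩ := Ideal.Quotient.mk_surjective y
    have hs : s ∈ maximalIdeal S := Ideal.Quotient.eq_zero_iff_mem.1 hy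
    rw [← hx, ← hJ] at hs
    obtain ⟨m, hm⟩ := hs
    exact mem_nilradical.2 ⟨m, by rw [← map_pow]; exact Ideal.Quotient.eq_zero_iff_mem.2 hm⟩
  have h2 : (J • ⊤ : Submodule (MvPowerSeries (Fin n) k) S) = 𝔞.restrictScalars _ :=
    Ideal.smul_top_eq_map J
  have : Module.Finite (MvPowerSeries (Fin n) k)
      (S ⧸ (J • ⊤ : Submodule (MvPowerSeries (Fin n) k) S)) := by
    rw [h2]; exact hfin
  exact Module.Finite.of_isPrecomplete_of_isHausdorff J

theorem maximalIdeal_eq_span {k σ : Type*} [Field k] [Fintype σ] :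
    maximalIdeal (MvPowerSeries σ k) = Ideal.span (Set.range X) := by
  apply le_antisymm
  · intro h hh
    have := (mem_span_range_X_pow_iff 1 h).2 fun α hα ↦ by
      have h0 : α = 0 := Finsupp.ext fun i ↦ by simpa using hα i
      rw [h0]
      by_contra hne
      exact hh (isUnit_iff_constantCoeff.2 (isUnit_iff_ne_zero.2 hne))
    simpa using this
  · rw [Ideal.span_le]
    rintro _ ⟨i, rfl⟩
    intro h
    simpa using isUnit_iff_constantCoeff.1 h

theorem ringKrullDim_le {k : Type*} [Field k] (n : ℕ) :
    ringKrullDim (MvPowerSeries (Fin n) k) ≤ n := by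
  refine (ringKrullDim_le_spanFinrank_maximalIdeal _).trans ?_
  rw [maximalIdeal_eq_span]
  have h1 := Submodule.spanFinrank_span_le_ncard_of_finite (R := MvPowerSeries (Fin n) k)
    (Set.finite_range (X : Fin n → MvPowerSeries (Fin n) k))
  have h2 : (Set.range (X : Fin n → MvPowerSeries (Fin n) k)).ncard ≤ n := by
    rw [← Set.image_univ]
    exact (Set.ncard_image_le).trans (by simp)
  exact_mod_cast h1.trans h2

end MvPowerSeries

theorem ringKrullDim_le_of_isIntegral (A S : Type*) [CommRing A] [CommRing S] [Algebra A S]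
    [Algebra.IsIntegral A S] : ringKrullDim S ≤ ringKrullDim A := by
  refine Order.krullDim_le_of_strictMono (PrimeSpectrum.comap (algebraMap A S)) ?_
  intro P Q hPQ
  obtain ⟨hle, x, hxQ, hxP⟩ := SetLike.lt_iff_le_and_exists.1 (show P.asIdeal < Q.asIdeal from hPQ)
  exact Ideal.comap_lt_comap_of_integral_mem_sdiff hle ⟨hxQ, hxP⟩
    (Algebra.IsIntegral.isIntegral x)

theorem RingHom.injective_of_finite_of_ringKrullDim_le {A S : Type*} [CommRing A] [CommRing S]
    [IsDomain A] [Nontrivial S] (g : A →+* S) (hg : g.Finite) {n : ℕ}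
    (hA : ringKrullDim A ≤ n) (hS : n ≤ ringKrullDim S) : Function.Injective g := by
  rw [injective_iff_map_eq_zero]
  intro a ha
  by_contra hne
  have h1 := ringKrullDim_quotient_succ_le_of_nonZeroDivisor (mem_nonZeroDivisors_of_ne_zero hne)
  let g' : A ⧸ Ideal.span {a} →+* S := Ideal.Quotient.lift _ g fun b hb ↦ by
    obtain ⟨c, rfl⟩ := Ideal.mem_span_singleton'.1 hb
    rw [map_mul, ha, mul_zero]
  have hg' : g'.Finite := RingHom.Finite.of_comp_finite (f := Ideal.Quotient.mk _) hg
  algebraize [g']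
  have h2 := ringKrullDim_le_of_isIntegral (A ⧸ Ideal.span {a}) S
  have h3 := (add_le_add_left (hS.trans h2) 1).trans (h1.trans hA)
  have : ((n + 1 : ℕ) : WithBot ℕ∞) ≤ (n : ℕ) := by exact_mod_cast h3
  have : n + 1 ≤ n := by exact_mod_cast this
  omega

theorem colon_of_initial {B : Type*} [CommRing B] (y : ℕ → B) (n : ℕ)
    (hy : ∀ j < n, ∀ b, y j * b ∈ Ideal.span (y '' {i | i < j}) → b ∈ Ideal.span (y '' {i | i < j}))
    (m : ℕ) (hm : m ≤ n) (j : ℕ) (hj : j < m) (b : B)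
    (hb : y j * b ∈ Ideal.span (y '' {i | i < m ∧ i ≠ j})) :
    b ∈ Ideal.span (y '' {i | i < m ∧ i ≠ j}) := by
  induction m generalizing b with
  | zero => omega
  | succ m ih =>
    rcases Nat.lt_succ_iff_lt_or_eq.mp hj with h | rfl
    · have e : {i | i < m + 1 ∧ i ≠ j} = insert m {i | i < m ∧ i ≠ j} := by
        ext i; simp only [Set.mem_ofPred_eq, Set.mem_insert_iff]; omega
      have e' : {i | i < m} = insert j {i | i < m ∧ i ≠ j} := by
        ext i; simp only [Set.mem_ofPred_eq, Set.mem_insert_iff]; omega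
      rw [e, Set.image_insert_eq, Ideal.mem_span_insert] at hb ⊢
      obtain ⟨c, z, hz, hcz⟩ := hb
      have hc : c ∈ Ideal.span (y '' {i | i < m}) := by
        refine hy m hm c ?_
        rw [e', Set.image_insert_eq, Ideal.mem_span_insert]
        exact ⟨b, -z, neg_mem hz, by linear_combination -hcz⟩
      rw [e', Set.image_insert_eq, Ideal.mem_span_insert] at hc
      obtain ⟨v, w, hw, rfl⟩ := hc
      refine ⟨v, b - v * y m, ih (by omega) h _ ?_, by ring⟩
      have : y j * (b - v * y m) = z + y m * w := by linear_combination hcz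
      rw [this]
      exact add_mem hz (Ideal.mul_mem_left _ _ hw)
    · have e : {i | i < j + 1 ∧ i ≠ j} = {i | i < j} := by
        ext i; simp only [Set.mem_ofPred_eq]; omega
      rw [e] at hb ⊢
      exact hy j hm b hb

theorem initial_colon_update_pow {B : Type*} [CommRing B] (y : ℕ → B) (n : ℕ)
    (hy : ∀ j < n, ∀ b, y j * b ∈ Ideal.span (y '' {i | i < j}) → b ∈ Ideal.span (y '' {i | i < j}))
    (k a : ℕ) : ∀ j < n, ∀ b, Function.update y k (y k ^ a) j * b ∈
      Ideal.span (Function.update y k (y k ^ a) '' {i | i < j}) →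
      b ∈ Ideal.span (Function.update y k (y k ^ a) '' {i | i < j}) := by
  have himg : ∀ (a : ℕ) (s : Set ℕ), k ∉ s → Function.update y k (y k ^ a) '' s = y '' s := by
    intro a s hs
    refine Set.image_congr fun i hi ↦ Function.update_of_ne ?_ _ _
    rintro rfl; exact hs hi
  induction a with
  | zero =>
    intro j hj b hb
    rcases lt_trichotomy j k with h | rfl | h
    · rw [himg _ _ (by simp; omega)] at hb ⊢
      rw [Function.update_of_ne h.ne] at hb
      exact hy j hj b hb
    · simpa using hb
    · have : Ideal.span (Function.update y k (y k ^ 0) '' {i | i < j}) = ⊤ :=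
        Ideal.eq_top_of_isUnit_mem _ (Ideal.subset_span ⟨k, h, rfl⟩) (by simp)
      rw [this]; trivial
  | succ a ih =>
    intro j hj b hb
    rcases lt_trichotomy j k with h | rfl | h
    · rw [himg _ _ (by simp; omega)] at hb ⊢
      rw [Function.update_of_ne h.ne] at hb
      exact hy j hj b hb
    · rw [himg _ _ (by simp)] at hb ⊢
      have := ih j hj
      rw [himg _ _ (by simp)] at this
      simp only [Function.update_self] at this hb
      refine hy j hj b (this _ ?_)
      convert hb using 1; ring
    · have e : {i | i < j} = insert k {i | i < j ∧ i ≠ k} := by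
        ext i; simp only [Set.mem_ofPred_eq, Set.mem_insert_iff]; omega
      have h1 := fun a ↦ himg a {i | i < j ∧ i ≠ k} (by simp)
      have h2 := ih j hj b
      have h3 := colon_of_initial _ n ih j hj.le k h
      rw [Function.update_of_ne h.ne'] at hb h2
      have h4 := hy j hj
      rw [e, Set.image_insert_eq] at hb h2 h4 ⊢
      rw [h1] at hb h2 h3 ⊢
      simp only [Function.update_self, Ideal.mem_span_insert] at hb h2 h3 ⊢
      obtain ⟨η, w', hw', hη⟩ := hb
      obtain ⟨ζ, w, hw, rfl⟩ := h2 ⟨η * y k, w', hw', by rw [hη]; ring⟩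
      have h5 := h3 (y k * η - y j * ζ) (by
        have : y k ^ a * (y k * η - y j * ζ) = y j * w - w' := by linear_combination -hη
        rw [this]
        exact sub_mem (Ideal.mul_mem_left _ _ hw) hw')
      have h6 := h4 ζ (by
        rw [Ideal.mem_span_insert]
        exact ⟨η, _, neg_mem h5, by ring⟩)
      rw [Ideal.mem_span_insert] at h6
      obtain ⟨v, u, hu, rfl⟩ := h6
      exact ⟨v, y k ^ a * u + w, add_mem (Ideal.mul_mem_left _ _ hu) hw, by ring⟩

theorem initial_colon_pow {B : Type*} [CommRing B] (y : ℕ → B) (n : ℕ)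
    (hy : ∀ j < n, ∀ b, y j * b ∈ Ideal.span (y '' {i | i < j}) → b ∈ Ideal.span (y '' {i | i < j}))
    (a : ℕ → ℕ) : ∀ j < n, ∀ b, y j ^ a j * b ∈ Ideal.span ((fun i ↦ y i ^ a i) '' {i | i < j}) →
      b ∈ Ideal.span ((fun i ↦ y i ^ a i) '' {i | i < j}) := by
  have key : ∀ m : ℕ, ∀ j < n, ∀ b, (fun i ↦ if i < m then y i ^ a i else y i) j * b ∈
      Ideal.span ((fun i ↦ if i < m then y i ^ a i else y i) '' {i | i < j}) →
      b ∈ Ideal.span ((fun i ↦ if i < m then y i ^ a i else y i) '' {i | i < j}) := by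
    intro m
    induction m with
    | zero => simpa using hy
    | succ m ih =>
      have := initial_colon_update_pow _ n ih m (a m)
      have e : Function.update (fun i ↦ if i < m then y i ^ a i else y i) m
          ((fun i ↦ if i < m then y i ^ a i else y i) m ^ a m) =
          fun i ↦ if i < m + 1 then y i ^ a i else y i := by
        funext i
        rcases eq_or_ne i m with rfl | h
        · simp
        · rw [Function.update_of_ne h]
          have : i < m ↔ i < m + 1 := by omega
          simp only [this]
      rwa [e] at this
  intro j hj b hb
  have e : (fun i ↦ if i < n then y i ^ a i else y i) '' {i | i < j} =
      (fun i ↦ y i ^ a i) '' {i | i < j} := by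
    refine Set.image_congr fun i (hi : i < j) ↦ ?_
    simp [hi.trans hj]
  have := key n j hj b
  rw [e] at this
  simp only [hj, if_true] at this
  exact this hb

/-- A family `y` is monomially regular if multiplication by monomials in `y` induces injections
between quotients by powers of `y`. -/
def MonReg {ι B : Type*} [CommRing B] [Fintype ι] (y : ι → B) : Prop :=
  ∀ (a β : ι → ℕ) (b : B), (∏ i, y i ^ β i) * b ∈ Ideal.span (Set.range fun i ↦ y i ^ (a i + β i)) →
    b ∈ Ideal.span (Set.range fun i ↦ y i ^ a i)

theorem MonReg.of_colon {ι B : Type*} [CommRing B] [Fintype ι] [DecidableEq ι] (y : ι → B)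
    (h : ∀ (a : ι → ℕ) (j : ι) (e : ℕ) (b : B),
      y j ^ e * b ∈ Ideal.span ((fun i ↦ y i ^ a i) '' {i | i ≠ j}) →
      b ∈ Ideal.span ((fun i ↦ y i ^ a i) '' {i | i ≠ j})) : MonReg y := by
  have strip : ∀ (a : ι → ℕ) (j : ι) (e : ℕ) (b : B),
      y j ^ e * b ∈ Ideal.span (Set.range fun i ↦ y i ^ (a i + (Pi.single j e : ι → ℕ) i)) →
      b ∈ Ideal.span (Set.range fun i ↦ y i ^ a i) := by
    intro a j e b hb
    have eu : (Set.univ : Set ι) = insert j {i | i ≠ j} := by ext i; simp; tauto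
    rw [← Set.image_univ, eu, Set.image_insert_eq, Ideal.mem_span_insert] at hb ⊢
    obtain ⟨c, z, hz, hcz⟩ := hb
    have e1 : (fun i ↦ y i ^ (a i + (Pi.single j e : ι → ℕ) i)) '' {i | i ≠ j} =
        (fun i ↦ y i ^ a i) '' {i | i ≠ j} :=
      Set.image_congr fun i (hi : i ≠ j) ↦ by simp [hi]
    rw [e1] at hz
    refine ⟨c, b - c * y j ^ a j, h a j e _ ?_, by ring⟩
    convert hz using 1
    simp only [Pi.single_eq_same, pow_add] at hcz
    linear_combination hcz
  have key : ∀ (s : Finset ι) (a β : ι → ℕ) (b : B), (∏ i ∈ s, y i ^ β i) * b ∈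
      Ideal.span (Set.range fun i ↦ y i ^ (a i + if i ∈ s then β i else 0)) →
      b ∈ Ideal.span (Set.range fun i ↦ y i ^ a i) := by
    intro s
    induction s using Finset.induction_on with
    | empty => intro a β b hb; simpa using hb
    | insert j s hj ih =>
      intro a β b hb
      refine strip a j (β j) b (ih _ β _ ?_)
      rw [Finset.prod_insert hj] at hb
      have e1 : (∏ i ∈ s, y i ^ β i) * (y j ^ β j * b) = (y j ^ β j * ∏ i ∈ s, y i ^ β i) * b := by
        ring
      have e2 : (fun i ↦ y i ^ (a i + (Pi.single j (β j) : ι → ℕ) i + if i ∈ s then β i else 0)) =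
          fun i ↦ y i ^ (a i + if i ∈ insert j s then β i else 0) := by
        funext i
        congr 1
        rcases eq_or_ne i j with rfl | hij
        · simp [hj]
        · simp [hij]
      rw [e1, e2]
      exact hb
  intro a β b hb
  exact key Finset.univ a β b (by simpa using hb)

theorem MonReg.of_isWeaklyRegular {B : Type*} [CommRing B] {n : ℕ} (y : Fin n → B)
    (hy : RingTheory.Sequence.IsWeaklyRegular B (List.ofFn y)) : MonReg y := by
  set Y : ℕ → B := fun i ↦ if h : i < n then y ⟨i, h⟩ else 0 with hY
  have hYy : ∀ i : Fin n, Y i = y i := fun i ↦ by simp [hY]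
  have h1 : ∀ j < n, ∀ b, Y j * b ∈ Ideal.span (Y '' {i | i < j}) →
      b ∈ Ideal.span (Y '' {i | i < j}) := by
    intro j hj b hb
    have h2 := hy.regular_mod_prev j (by simpa using hj)
    have e : Ideal.ofList (List.take j (List.ofFn y)) = Ideal.span (Y '' {i | i < j}) := by
      rw [Ideal.ofList]
      congr 1
      ext z
      simp only [List.mem_take_iff_getElem, Set.mem_ofPred_eq, Set.mem_image]
      constructor
      · rintro ⟨i, hi, rfl⟩
        simp only [List.length_ofFn, lt_min_iff] at hi
        exact ⟨i, hi.1, by simp [hY, hi.2]⟩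
      · rintro ⟨i, hi, rfl⟩
        have : i < n := hi.trans hj
        exact ⟨i, by simp; omega, by simp [hY, this]⟩
    rw [e] at h2
    have h3 := mem_of_isSMulRegular_quotient_of_smul_mem h2 (x := b)
    simp only [smul_eq_mul, Ideal.mul_top, List.getElem_ofFn] at h3
    refine h3 ?_
    simpa [hY, hj] using hb
  refine MonReg.of_colon y fun a j e b hb ↦ ?_
  have h2 := initial_colon_pow Y n h1
    (fun i ↦ if h : i < n then (if i = j then e else a ⟨i, h⟩) else 0)
  have h3 := colon_of_initial _ n h2 n le_rfl j j.2 b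
  have e1 : (fun i ↦ Y i ^ (if h : i < n then (if i = j then e else a ⟨i, h⟩) else 0)) ''
      {i | i < n ∧ i ≠ j} = (fun i ↦ y i ^ a i) '' {i | i ≠ j} := by
    ext z
    constructor
    · rintro ⟨i, ⟨hi, hij⟩, rfl⟩
      exact ⟨⟨i, hi⟩, by simpa [Fin.ext_iff] using hij, by simp [hY, hi, hij]⟩
    · rintro ⟨i, hij, rfl⟩
      have : (i : ℕ) ≠ j := by simpa [Fin.ext_iff] using hij
      exact ⟨i, ⟨i.2, this⟩, by simp [hY, this]⟩
  rw [e1] at h3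
  simp only [j.2, dif_pos, if_true, hYy] at h3
  exact h3 hb

/-- A finite module over a domain is, up to multiplication by a nonzero scalar `d`, a retract of a
finite free module. -/
theorem Module.Finite.exists_smul_eq_sum {D : Type*} [CommRing D] [IsDomain D] (W : Type*)
    [AddCommGroup W] [Module D W] [Module.Finite D W] :
    ∃ (r : ℕ) (d : D) (α : W →ₗ[D] (Fin r → D)) (v : Fin r → W), d ≠ 0 ∧
      ∀ x, d • x = ∑ i, α x i • v i := by
  obtain ⟨m, g, hg⟩ := Module.Finite.exists_fin (R := D) (M := W)
  obtain ⟨I, hI, hmax⟩ := exists_maximal_linearIndepOn D g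
  have : ∀ i, ∃ a : D, a ≠ 0 ∧ a • g i ∈ Submodule.span D (g '' I) := by
    intro i
    by_cases hi : i ∈ I
    · exact ⟨1, one_ne_zero, by
        rw [one_smul]; exact Submodule.subset_span (Set.mem_image_of_mem g hi)⟩
    · exact hmax i hi
  choose a ha0 ha using this
  set d := ∏ i, a i with hd
  have hdW : ∀ x : W, d • x ∈ Submodule.span D (g '' I) := by
    intro x
    have hx : x ∈ Submodule.span D (Set.range g) := hg ▸ Submodule.mem_top
    induction hx using Submodule.span_induction with
    | mem x hx =>
      obtain ⟨i, rfl⟩ := hx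
      rw [hd, ← Finset.prod_erase_mul _ _ (Finset.mem_univ i), mul_smul]
      exact Submodule.smul_mem _ _ (ha i)
    | zero => simp
    | add x y _ _ hx hy => rw [smul_add]; exact add_mem hx hy
    | smul c x _ hx => rw [smul_comm]; exact Submodule.smul_mem _ _ hx
  have hI' : LinearIndependent D (fun i : I ↦ g i) := hI
  have hspan : Submodule.span D (Set.range fun i : I ↦ g i) = Submodule.span D (g '' I) := by
    rw [Set.image_eq_range]
  let b := Module.Basis.span hI'
  have : Finite I := inferInstance
  let e : I ≃ Fin (Nat.card I) := Finite.equivFin I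
  let b' := b.reindex e
  let L : W →ₗ[D] Submodule.span D (Set.range fun i : I ↦ g i) :=
    (LinearMap.lsmul D W d).codRestrict _ fun x ↦ by rw [hspan]; exact hdW x
  refine ⟨Nat.card I, d, b'.equivFun.toLinearMap ∘ₗ L, fun i ↦ (b' i : W),
    Finset.prod_ne_zero_iff.mpr fun i _ ↦ ha0 i, fun x ↦ ?_⟩
  have := congrArg Subtype.val (b'.sum_equivFun (L x))
  rw [AddSubmonoidClass.coe_finsetSum] at this
  exact this.symm

theorem Module.Finite.exists_dual_apply_ne_zero {D : Type*} [CommRing D] [IsDomain D] {W : Type*}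
    [AddCommGroup W] [Module D W] [Module.Finite D W] (θ : W) (hθ : ∀ d : D, d ≠ 0 → d • θ ≠ 0) :
    ∃ χ : W →ₗ[D] D, χ θ ≠ 0 := by
  obtain ⟨r, d, α, v, hd, h⟩ := exists_smul_eq_sum (D := D) W
  by_contra! hc
  refine hθ d hd ?_
  rw [h]
  exact Finset.sum_eq_zero fun i _ ↦ by
    rw [show α θ i = 0 from hc (LinearMap.proj i ∘ₗ α), zero_smul]

theorem exists_smul_mem_map_of_smul_mem_map {D S : Type*} [CommRing D] [IsDomain D] [CommRing S]
    [Algebra D S] [Module.Finite D S] :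
    ∃ d : D, d ≠ 0 ∧ ∀ (z : D) (J J' : Ideal D), (∀ a, z * a ∈ J → a ∈ J') →
      ∀ s : S, z • s ∈ J.map (algebraMap D S) → d • s ∈ J'.map (algebraMap D S) := by
  obtain ⟨r, d, α, v, hd, h⟩ := Module.Finite.exists_smul_eq_sum (D := D) S
  refine ⟨d, hd, fun z J J' hJ s hs ↦ ?_⟩
  rw [h]
  refine Ideal.sum_mem _ fun i _ ↦ ?_
  rw [Algebra.smul_def]
  refine Ideal.mul_mem_right _ _ (Ideal.mem_map_of_mem _ (hJ _ ?_))
  have key : ∀ y ∈ J • (⊤ : Submodule D S), α y i ∈ J := by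
    intro y hy
    exact Submodule.smul_induction_on hy (fun c hc y _ ↦ by simpa using J.mul_mem_right _ hc)
      fun x y hx hy ↦ by simpa using J.add_mem hx hy
  simpa using key (z • s) (by rw [Ideal.smul_top_eq_map]; exact hs)

theorem LinearMap.exists_comp_eq_of_ker_le {k V V' W : Type*} [Field k] [AddCommGroup V]
    [Module k V] [AddCommGroup V'] [Module k V'] [AddCommGroup W] [Module k W]
    (f : V →ₗ[k] V') (g : V →ₗ[k] W) (h : ker f ≤ ker g) : ∃ μ : V' →ₗ[k] W, μ ∘ₗ f = g := by
  obtain ⟨s, hs⟩ := ((ker f).liftQ f le_rfl).exists_leftInverse_of_injective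
    (by simp [Submodule.ker_liftQ])
  refine ⟨(ker f).liftQ g h ∘ₗ s, ?_⟩
  ext x
  have := LinearMap.congr_fun hs ((ker f).mkQ x)
  simp only [coe_comp, Function.comp_apply, Submodule.mkQ_apply, Submodule.liftQ_apply,
    id_coe, id_eq] at this
  simp [this]

/-- A compatible family of functionals modulo the powers of a monomially regular family. -/
theorem MonReg.exists_functional_seq {k ι B : Type*} [Field k] [Fintype ι] [CommRing B]
    [Algebra k B] (y : ι → B) (hy : MonReg y) (h1 : (1 : B) ∉ Ideal.span (Set.range y)) :
    ∃ l : ℕ → B →ₗ[k] k, l 0 1 ≠ 0 ∧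
      (∀ n, ∀ b ∈ Ideal.span (Set.range fun i ↦ y i ^ (n + 1)), l n b = 0) ∧
      ∀ n b, l (n + 1) ((∏ i, y i) * b) = l n b := by
  let I : ℕ → Ideal B := fun n ↦ Ideal.span (Set.range fun i ↦ y i ^ (n + 1))
  have step : ∀ n (m : B →ₗ[k] k), (∀ b ∈ I n, m b = 0) → ∃ m' : B →ₗ[k] k,
      (∀ b ∈ I (n + 1), m' b = 0) ∧ ∀ b, m' ((∏ i, y i) * b) = m b := by
    intro n m hm
    let q := (Ideal.Quotient.mkₐ k (I (n + 1))).toLinearMap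
    obtain ⟨μ, hμ⟩ := LinearMap.exists_comp_eq_of_ker_le (q ∘ₗ LinearMap.mulLeft k (∏ i, y i)) m
      (by
        intro b hb
        have hb' : (∏ i, y i) * b ∈ I (n + 1) := by
          simpa [q, Ideal.Quotient.eq_zero_iff_mem, -map_mul] using hb
        exact hm b (hy (fun _ ↦ n + 1) (fun _ ↦ 1) b (by simpa using hb')))
    refine ⟨μ ∘ₗ q, fun b hb ↦ ?_, fun b ↦ LinearMap.congr_fun hμ b⟩
    have : q b = 0 := Ideal.Quotient.eq_zero_iff_mem.mpr hb
    simp [this]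
  obtain ⟨l0, hl1, hl0⟩ := Submodule.exists_le_ker_of_notMem
    (p := (Ideal.span (Set.range y)).restrictScalars k) (v := (1 : B)) h1
  choose! F hF using step
  let l : ℕ → B →ₗ[k] k := fun n ↦ Nat.rec l0 (fun n m ↦ F n m) n
  have hl : ∀ n, ∀ b ∈ I n, l n b = 0 := by
    intro n
    induction n with
    | zero => intro b hb; exact hl0 (by simpa [I] using hb)
    | succ n ih => exact (hF n _ ih).1
  exact ⟨l, hl1, hl, fun n ↦ (hF n _ (hl n)).2⟩

theorem MonReg.exists_functional {k ι B : Type*} [Field k] [Fintype ι] [CommRing B]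
    [Algebra (MvPowerSeries ι k) B]
    (hy : MonReg fun i : ι ↦ algebraMap (MvPowerSeries ι k) B (MvPowerSeries.X i))
    (h1 : (1 : B) ∉
      Ideal.span (Set.range fun i : ι ↦ algebraMap (MvPowerSeries ι k) B (MvPowerSeries.X i))) :
    ∃ ψ : B →ₗ[MvPowerSeries ι k] MvPowerSeries ι k, ψ 1 ≠ 0 := by
  classical
  let _ : Algebra k B := ((algebraMap (MvPowerSeries ι k) B).comp MvPowerSeries.C).toAlgebra
  set y : ι → B := fun i ↦ algebraMap (MvPowerSeries ι k) B (MvPowerSeries.X i) with hydef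
  obtain ⟨l, hl1, hl0, hls⟩ := hy.exists_functional_seq (k := k) y h1
  let mon : ℕ → (ι →₀ ℕ) → B := fun n α ↦ ∏ i, y i ^ (n - α i)
  have hshift : ∀ (α : ι →₀ ℕ) n, (∀ i, α i ≤ n) → ∀ m, n ≤ m → ∀ b,
      l m (mon m α * b) = l n (mon n α * b) := by
    intro α n hn m hm b
    induction m, hm using Nat.le_induction with
    | base => rfl
    | succ m hm ih =>
      have e : mon (m + 1) α * b = (∏ i, y i) * (mon m α * b) := by
        rw [← mul_assoc]
        congr 1
        simp only [mon]
        rw [← Finset.prod_mul_distrib]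
        refine Finset.prod_congr rfl fun i _ ↦ ?_
        have := hn i
        rw [← pow_succ']
        congr 1
        omega
      rw [← ih, e, hls]
  have hdeg : ∀ (α : ι →₀ ℕ) i, α i ≤ α.degree := fun α i ↦ Finsupp.le_degree i α
  let ψ : B →ₗ[k] MvPowerSeries ι k :=
    { toFun := fun b α ↦ l α.degree (mon α.degree α * b)
      map_add' := fun b c ↦ by ext α; simp [MvPowerSeries.coeff_apply, mul_add]; rfl
      map_smul' := fun a b ↦ by ext α; simp [MvPowerSeries.coeff_apply]; rfl }
  have hψ : ∀ (α : ι →₀ ℕ) n, (∀ i, α i ≤ n) → ∀ b,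
      MvPowerSeries.coeff α (ψ b) = l n (mon n α * b) := by
    intro α n hn b
    rw [← hshift α n hn (max n α.degree) (le_max_left _ _),
      hshift α _ (hdeg α) (max n α.degree) (le_max_right _ _)]
    rfl
  have hX : ∀ i b, ψ (y i * b) = MvPowerSeries.X i * ψ b := by
    intro i b
    ext α
    rw [hψ α _ (hdeg α), MvPowerSeries.X, MvPowerSeries.coeff_monomial_mul]
    split_ifs with h
    · rw [one_mul, hψ _ α.degree (fun j ↦ (Nat.sub_le _ _).trans (hdeg α j)), ← mul_assoc]
      congr 2
      have h' : 1 ≤ α i := by simpa using h i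
      have : mon α.degree (α - Finsupp.single i 1) =
          ∏ j, y j ^ (α.degree - α j) * (if j = i then y i else 1) := by
        refine Finset.prod_congr rfl fun j _ ↦ ?_
        rcases eq_or_ne j i with rfl | hj
        · have := hdeg α j
          rw [if_pos rfl, ← pow_succ]
          congr 1
          simp; omega
        · simp [hj, Finsupp.single_eq_of_ne hj]
      rw [this, Finset.prod_mul_distrib]
      simp [mon]
    · apply hl0
      have h' : α i = 0 := by
        by_contra h0
        exact h (by simpa [Finsupp.single_le_iff] using Nat.one_le_iff_ne_zero.mpr h0)
      change (∏ j, y j ^ (α.degree - α j)) * _ ∈ _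
      rw [← Finset.prod_erase_mul _ _ (Finset.mem_univ i)]
      have : y i ^ (α.degree - α i) * y i = y i ^ (α.degree + 1) := by rw [h', ← pow_succ]; rfl
      rw [mul_assoc, ← mul_assoc (y i ^ _), this]
      exact Ideal.mul_mem_left _ _ (Ideal.mul_mem_right _ _ (Ideal.subset_span ⟨i, rfl⟩))
  have hpoly : ∀ (P : MvPolynomial ι k) b, ψ (algebraMap (MvPowerSeries ι k) B P * b) =
      (P : MvPowerSeries ι k) * ψ b := by
    intro P b
    induction P using MvPolynomial.induction_on generalizing b with
    | C a =>
      have := ψ.map_smul a b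
      rw [Algebra.smul_def] at this
      rw [MvPolynomial.coe_C, ← MvPowerSeries.smul_eq_C_mul]
      exact this
    | add p q hp hq => simp [add_mul, hp, hq]
    | mul_X p i hp =>
      rw [MvPolynomial.coe_mul, MvPolynomial.coe_X, map_mul (algebraMap (MvPowerSeries ι k) B),
        mul_assoc, hp, mul_assoc]
      congr 1
      exact hX i b
  have hXp : ∀ i n b, ψ (y i ^ n * b) = MvPowerSeries.X i ^ n * ψ b := by
    intro i n b
    induction n generalizing b with
    | zero => simp
    | succ n ih => rw [pow_succ, pow_succ, mul_assoc, ih, hX, mul_assoc]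
  let J : ℕ → Ideal (MvPowerSeries ι k) := fun N ↦
    Ideal.span (Set.range fun i ↦ (MvPowerSeries.X i : MvPowerSeries ι k) ^ N)
  have hJ : ∀ N, ∀ h ∈ J N, ∀ b, ψ (algebraMap (MvPowerSeries ι k) B h * b) ∈ J N := by
    intro N h hh
    induction hh using Submodule.span_induction with
    | mem h hh =>
      obtain ⟨i, rfl⟩ := hh
      intro b
      rw [map_pow]
      change ψ (y i ^ N * b) ∈ _
      rw [hXp]
      exact Ideal.mul_mem_right _ _ (Ideal.subset_span ⟨i, rfl⟩)
    | zero => intro b; simp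
    | add f g _ _ hf hg => intro b; rw [map_add, add_mul, map_add]; exact add_mem (hf b) (hg b)
    | smul c f _ hf =>
      intro b
      rw [smul_eq_mul, mul_comm c f, map_mul (algebraMap (MvPowerSeries ι k) B), mul_assoc]
      exact hf _
  have hlin : ∀ (h : MvPowerSeries ι k) b,
      ψ (algebraMap (MvPowerSeries ι k) B h * b) = h * ψ b := by
    intro h b
    rw [← sub_eq_zero]
    have hmem : ∀ N, ψ (algebraMap (MvPowerSeries ι k) B h * b) - h * ψ b ∈ J N := by
      intro N
      obtain ⟨P, hP⟩ := MvPowerSeries.exists_polynomial_sub_mem N h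
      have e : ψ (algebraMap (MvPowerSeries ι k) B h * b) - h * ψ b =
          ψ (algebraMap (MvPowerSeries ι k) B (h - P) * b) - (h - P) * ψ b := by
        rw [map_sub, sub_mul, map_sub, hpoly]; ring
      rw [e]
      exact sub_mem (hJ N _ hP b) (Ideal.mul_mem_right _ _ hP)
    ext α
    exact (MvPowerSeries.mem_span_range_X_pow_iff (α.degree + 1) _).1 (hmem _) α
      fun i ↦ Nat.lt_succ_of_le (hdeg α i)
  refine ⟨{ toFun := ψ, map_add' := ψ.map_add, map_smul' := fun h b ↦ ?_ }, fun h0 ↦ hl1 ?_⟩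
  · rw [Algebra.smul_def, hlin]; rfl
  · have := hψ 0 0 (by simp) 1
    have h0' : ψ 1 = 0 := h0
    rw [h0'] at this
    simpa [mon] using this.symm

theorem MonReg.exists_basis.{u₁, u₂, u₃} {k : Type u₁} {ι : Type u₂} {B : Type u₃} [Field k]
    [Fintype ι] [CommRing B] [Algebra (MvPowerSeries ι k) B]
    (hy : MonReg fun i : ι ↦ algebraMap (MvPowerSeries ι k) B (MvPowerSeries.X i)) (N : ℕ) :
    ∃ (κ : Type u₃) (b : κ → B),
      Submodule.span (MvPowerSeries ι k) (Set.range b) ⊔ Ideal.span (Set.range fun i : ι ↦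
        (MvPowerSeries.X i : MvPowerSeries ι k) ^ N) • (⊤ : Submodule (MvPowerSeries ι k) B) = ⊤ ∧
      ∀ F : κ →₀ MvPowerSeries ι k, Finsupp.linearCombination _ b F ∈
        Ideal.span (Set.range fun i : ι ↦
        (MvPowerSeries.X i : MvPowerSeries ι k) ^ N) • (⊤ : Submodule (MvPowerSeries ι k) B) →
        ∀ i, F i ∈
          Ideal.span (Set.range fun i : ι ↦ (MvPowerSeries.X i : MvPowerSeries ι k) ^ N) := by
  classical
  let _ : Algebra k B := ((algebraMap (MvPowerSeries ι k) B).comp MvPowerSeries.C).toAlgebra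
  have hkB : ∀ (c : k) (b : B), c • b = (MvPowerSeries.C c : MvPowerSeries ι k) • b := by
    intro c b
    rw [Algebra.smul_def, Algebra.smul_def]; rfl
  set y : ι → B := fun i ↦ algebraMap (MvPowerSeries ι k) B (MvPowerSeries.X i) with hydef
  let J : ℕ → Ideal (MvPowerSeries ι k) := fun N ↦
    Ideal.span (Set.range fun i ↦ (MvPowerSeries.X i : MvPowerSeries ι k) ^ N)
  let I : ℕ → Ideal B := fun N ↦ Ideal.span (Set.range fun i ↦ y i ^ N)
  have hJI : ∀ N (x : B), x ∈ J N • (⊤ : Submodule (MvPowerSeries ι k) B) ↔ x ∈ I N := by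
    intro N x
    rw [Ideal.smul_top_eq_map, Submodule.restrictScalars_mem, Ideal.map_span, ← Set.range_comp]
    simp [I, Function.comp_def, hydef]
  let e := Module.Basis.ofVectorSpace k (B ⧸ I 1)
  have hsurj : ∀ v : B ⧸ I 1, ∃ b : B, Ideal.Quotient.mk _ b = v := Ideal.Quotient.mk_surjective
  choose lift hlift using hsurj
  let b := fun i ↦ lift (e i)
  have hbase : ∀ F : _ →₀ k, Ideal.Quotient.mkₐ k (I 1) (F.sum fun i c ↦ c • b i) =
      Finsupp.linearCombination k e F := by
    intro F
    simp [Finsupp.linearCombination_apply, Finsupp.sum, b, hlift, map_sum, map_smul]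
  refine ⟨_, b, ?_, ?_⟩
  · set W := Submodule.span (MvPowerSeries ι k) (Set.range b)
    have h1 : W ⊔ J 1 • ⊤ = ⊤ := by
      rw [eq_top_iff]
      intro x _
      obtain ⟨F, hF⟩ : ∃ F, Finsupp.linearCombination k e F = Ideal.Quotient.mk _ x :=
        ⟨_, e.linearCombination_repr _⟩
      rw [← hbase] at hF
      have hx : x - (F.sum fun i c ↦ c • b i) ∈ I 1 := by
        rw [← Ideal.Quotient.eq_zero_iff_mem, map_sub, sub_eq_zero]
        exact hF.symm
      rw [Submodule.mem_sup]
      refine ⟨_, ?_, _, (hJI 1 _).mpr hx, add_sub_cancel _ _⟩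
      refine Submodule.sum_mem _ fun i _ ↦ ?_
      change F i • b i ∈ W
      rw [hkB]
      exact W.smul_mem _ (Submodule.subset_span ⟨i, rfl⟩)
    have h2 : ∀ n, W ⊔ J 1 ^ n • ⊤ = ⊤ := by
      intro n
      induction n with
      | zero => rw [pow_zero, Ideal.one_eq_top, Submodule.top_smul, sup_top_eq]
      | succ n ih =>
        rw [eq_top_iff]
        calc (⊤ : Submodule (MvPowerSeries ι k) B) = W ⊔ J 1 • (W ⊔ J 1 ^ n • ⊤) := by rw [ih, h1]
          _ ≤ W ⊔ J 1 ^ (n + 1) • ⊤ := by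
            rw [Submodule.smul_sup, ← Submodule.mul_smul, ← pow_succ', ← sup_assoc]
            exact sup_le_sup_right (sup_le le_rfl Submodule.smul_le_right) _
    obtain ⟨n, hn⟩ := Ideal.exists_pow_le_of_le_radical_of_fg (I := J 1) (J := J N)
      (by
        rw [Ideal.span_le]
        rintro _ ⟨i, rfl⟩
        exact ⟨N, Ideal.subset_span ⟨i, by simp⟩⟩)
      (Submodule.fg_span (Set.finite_range _))
    refine top_le_iff.mp ((h2 n).ge.trans ?_)
    exact sup_le_sup_left (Submodule.smul_mono_left hn) _
  · intro F hF
    by_contra! hcon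
    obtain ⟨i0, hi0⟩ := hcon
    rw [MvPowerSeries.mem_span_range_X_pow_iff] at hi0
    push Not at hi0
    have hex : ∃ m, ∃ (α : ι →₀ ℕ) (i : _), α.degree = m ∧ (∀ j, α j < N) ∧
        MvPowerSeries.coeff α (F i) ≠ 0 := by
      obtain ⟨α, h1, h2⟩ := hi0
      exact ⟨_, α, i0, rfl, h1, h2⟩
    obtain ⟨α, i, hα, hαN, hαi⟩ := Nat.find_spec hex
    have hmin : ∀ (δ : ι →₀ ℕ) i, δ.degree < α.degree → (∀ j, δ j < N) →
        MvPowerSeries.coeff δ (F i) = 0 := by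
      intro δ i hδ hδN
      by_contra h
      exact Nat.find_min hex (hα ▸ hδ) ⟨δ, i, rfl, hδN, h⟩
    let β : ι →₀ ℕ := Finsupp.equivFunOnFinite.symm fun j ↦ N - 1 - α j
    let γ : ι →₀ ℕ := Finsupp.equivFunOnFinite.symm fun j ↦ N - 1
    have hβγ : β + α = γ := by
      ext j
      have := hαN j
      simp [β, γ]; omega
    have hred : ∀ i, MvPowerSeries.monomial β 1 * F i -
        MvPowerSeries.monomial γ (MvPowerSeries.coeff α (F i)) ∈ J N := by
      intro i
      rw [MvPowerSeries.mem_span_range_X_pow_iff]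
      intro ε hε
      rw [map_sub, MvPowerSeries.coeff_monomial_mul, MvPowerSeries.coeff_monomial, one_mul]
      by_cases h : ε = γ
      · subst h
        rw [if_pos (by rw [← hβγ]; exact le_self_add), if_pos rfl, sub_eq_zero]
        congr 2
        rw [← hβγ]; simp
      · rw [if_neg h, sub_zero]
        split_ifs with h'
        · refine hmin _ _ ?_ fun j ↦ (Nat.sub_le _ _).trans_lt (hε j)
          have h1 : ε ≤ γ := fun j ↦ by
            have := hε j
            simp [γ]; omega
          have h2 : ε - β ≤ α := by
            rw [← hβγ] at h1
            exact tsub_le_iff_left.mpr h1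
          have h3 : ε - β ≠ α := fun h3 ↦ h (by rw [← hβγ, ← h3, add_tsub_cancel_of_le h'])
          have h4 : (ε - β).degree + (α - (ε - β)).degree = α.degree := by
            rw [← map_add, add_tsub_cancel_of_le h2]
          have h5 : (α - (ε - β)).degree ≠ 0 := by
            rw [Ne, Finsupp.degree_eq_zero_iff, tsub_eq_zero_iff_le]
            exact fun h ↦ h3 (le_antisymm h2 h)
          omega
        · rfl
    let c : _ →₀ k := F.mapRange (MvPowerSeries.coeff α) (map_zero _)
    have hc : (∏ j, y j ^ (N - 1)) * (c.sum fun i c ↦ c • b i) ∈ I N := by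
      have e1 : algebraMap (MvPowerSeries ι k) B (MvPowerSeries.monomial γ 1) =
          ∏ j, y j ^ (N - 1) := by
        rw [MvPowerSeries.monomial_one_eq, Finsupp.prod_fintype _ _ (by simp), map_prod]
        simp [hydef, γ]
      rw [← hJI, ← e1, ← Algebra.smul_def]
      have e2 : c.sum (fun i c ↦ c • b i) = ∑ i ∈ F.support, MvPowerSeries.coeff α (F i) • b i := by
        simp only [c]
        rw [Finsupp.sum_mapRange_index fun i ↦ zero_smul k (b i)]
        rfl
      have h3 := Submodule.smul_mem _ (MvPowerSeries.monomial β (1 : k)) hF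
      rw [Finsupp.linearCombination_apply, Finsupp.sum, Finset.smul_sum] at h3
      rw [e2, Finset.smul_sum]
      have h4 : ∑ i ∈ F.support, (MvPowerSeries.monomial β 1 * F i -
        MvPowerSeries.monomial γ (MvPowerSeries.coeff α (F i))) • b i ∈ J N • (⊤ : Submodule _ B) :=
        Submodule.sum_mem _ fun i _ ↦ Submodule.smul_mem_smul (hred i) trivial
      have h5 := sub_mem h3 h4
      rw [← Finset.sum_sub_distrib] at h5
      convert h5 using 1
      refine Finset.sum_congr rfl fun i _ ↦ ?_
      rw [hkB, sub_smul, mul_smul, sub_sub_cancel, ← mul_smul]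
      congr 1
      rw [← MvPowerSeries.monomial_zero_eq_C_apply, MvPowerSeries.monomial_mul_monomial]
      simp
    have hv := hy (fun _ ↦ 1) (fun _ ↦ N - 1) (c.sum fun i c ↦ c • b i) (by
      have e3 : (fun j ↦ y j ^ (1 + (N - 1))) = fun j ↦ y j ^ N := by
        funext j
        have := hαN j
        congr 1
        omega
      change _ ∈ Ideal.span (Set.range fun j ↦ y j ^ (1 + (N - 1)))
      rw [e3]
      exact hc)
    have hz : Finsupp.linearCombination k e c = 0 := by
      rw [← hbase]
      exact Ideal.Quotient.eq_zero_iff_mem.mpr hv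
    have hc0 : c = 0 := linearIndependent_iff.mp e.linearIndependent c hz
    have := DFunLike.congr_fun hc0 i
    exact hαi (by simpa [c] using this)

theorem LinearMap.exists_comp_eq_of_surjective {A V V' W : Type*} [CommRing A] [AddCommGroup V]
    [Module A V] [AddCommGroup V'] [Module A V'] [AddCommGroup W] [Module A W]
    (f : V →ₗ[A] V') (hf : Function.Surjective f) (g : V →ₗ[A] W) (h : ker f ≤ ker g) :
    ∃ μ : V' →ₗ[A] W, ∀ x, μ (f x) = g x := by
  refine ⟨(ker f).liftQ g h ∘ₗ (f.quotKerEquivOfSurjective hf).symm.toLinearMap, fun x ↦ ?_⟩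
  have : (f.quotKerEquivOfSurjective hf).symm (f x) = (ker f).mkQ x := by
    rw [LinearEquiv.symm_apply_eq]; rfl
  simp [this]

theorem MonReg.exists_coord {k ι B : Type*} [Field k] [Fintype ι] [CommRing B]
    [Algebra (MvPowerSeries ι k) B] {κ : Type*} (b : κ → B) (J : Ideal (MvPowerSeries ι k))
    (h1 : Submodule.span (MvPowerSeries ι k) (Set.range b) ⊔
      J • (⊤ : Submodule (MvPowerSeries ι k) B) = ⊤)
    (h2 : ∀ F : κ →₀ MvPowerSeries ι k, Finsupp.linearCombination _ b F ∈
        J • (⊤ : Submodule (MvPowerSeries ι k) B) → ∀ i, F i ∈ J) (i : κ) :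
    ∃ θ : B →ₗ[MvPowerSeries ι k] MvPowerSeries ι k ⧸ J,
      ∀ F : κ →₀ MvPowerSeries ι k, θ (Finsupp.linearCombination _ b F) =
        Ideal.Quotient.mk J (F i) := by
  let q := (J • (⊤ : Submodule (MvPowerSeries ι k) B)).mkQ
  obtain ⟨μ, hμ⟩ := LinearMap.exists_comp_eq_of_surjective
    (q ∘ₗ Finsupp.linearCombination (MvPowerSeries ι k) b)
    (by
      intro z
      obtain ⟨x, rfl⟩ := Submodule.mkQ_surjective _ z
      have hx : x ∈ Submodule.span (MvPowerSeries ι k) (Set.range b) ⊔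
        J • (⊤ : Submodule (MvPowerSeries ι k) B) := by rw [h1]; trivial
      obtain ⟨u, hu, v, hv, rfl⟩ := Submodule.mem_sup.mp hx
      obtain ⟨F, rfl⟩ := Finsupp.mem_span_range_iff_exists_finsupp.mp hu
      refine ⟨F, ?_⟩
      have : q v = 0 := (Submodule.Quotient.mk_eq_zero _).mpr hv
      rw [map_add]
      change q _ = q _ + q v
      rw [this, add_zero, Finsupp.linearCombination_apply])
    (J.mkQ ∘ₗ Finsupp.lapply i)
    (by
      intro F hF
      exact (Submodule.Quotient.mk_eq_zero _).mpr
        (h2 F ((Submodule.Quotient.mk_eq_zero _).mp hF) i))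
  exact ⟨μ ∘ₗ q, hμ⟩

/-- Modulo ideals containing powers of the variables, base change to a big Cohen-Macaulay algebra
commutes with colon ideals. -/
theorem MonReg.mem_map_of_smul_mem_map {k ι B S : Type*} [Field k] [Fintype ι] [CommRing B]
    [Algebra (MvPowerSeries ι k) B] [CommRing S] [Algebra (MvPowerSeries ι k) S]
    (hy : MonReg fun i : ι ↦ algebraMap (MvPowerSeries ι k) B (MvPowerSeries.X i))
    (J J' : Ideal S) (N : ℕ)
    (hJ : ∀ i : ι, algebraMap (MvPowerSeries ι k) S (MvPowerSeries.X i) ^ N ∈ J)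
    (z : S) (hz : ∀ s, z * s ∈ J → s ∈ J') (u : S ⊗[MvPowerSeries ι k] B)
    (hu : z • u ∈ J.map (algebraMap S (S ⊗[MvPowerSeries ι k] B))) :
    u ∈ J'.map (algebraMap S (S ⊗[MvPowerSeries ι k] B)) := by
  classical
  obtain ⟨κ, b, h1, h2⟩ := hy.exists_basis N
  set I := Ideal.span (Set.range fun i : ι ↦ (MvPowerSeries.X i : MvPowerSeries ι k) ^ N)
  set A := MvPowerSeries ι k
  have hIJ : ∀ a ∈ I, algebraMap A S a ∈ J := by
    intro a ha
    have : I ≤ J.comap (algebraMap A S) := by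
      rw [Ideal.span_le]
      rintro _ ⟨i, rfl⟩
      simpa using hJ i
    exact this ha
  choose θ hθ using MonReg.exists_coord b I h1 h2
  let φ : (A ⧸ I) →ₗ[A] S ⧸ J := I.liftQ (J.mkQ.restrictScalars A ∘ₗ Algebra.linearMap A S)
    (fun a ha ↦ Ideal.Quotient.eq_zero_iff_mem.mpr (hIJ a ha))
  let Θ : κ → (S ⊗[A] B) →ₗ[S] S ⧸ J := fun i ↦ (φ ∘ₗ θ i).liftBaseChange S
  have hΘb : ∀ i j s, Θ i (s ⊗ₜ b j) = if j = i then Ideal.Quotient.mk J s else 0 := by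
    intro i j s
    have := hθ i (Finsupp.single j 1)
    rw [Finsupp.linearCombination_single, one_smul] at this
    simp only [Θ, LinearMap.liftBaseChange_tmul, LinearMap.comp_apply]
    rw [this]
    rcases eq_or_ne j i with rfl | h
    · have e : φ (Ideal.Quotient.mk I 1) = Ideal.Quotient.mk J 1 := by
        change Ideal.Quotient.mk J (algebraMap A S 1) = _
        rw [map_one]
      rw [if_pos rfl, Finsupp.single_eq_same, e, map_one]
      exact (Algebra.smul_def _ _).trans (mul_one _)
    · rw [if_neg h, Finsupp.single_eq_of_ne h.symm]
      simp
  have hΘJ : ∀ i, ∀ v ∈ J.map (algebraMap S (S ⊗[A] B)), Θ i v = 0 := by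
    intro i v hv
    have hv' : v ∈ J • (⊤ : Submodule S (S ⊗[A] B)) := by
      rw [Ideal.smul_top_eq_map]; exact hv
    refine Submodule.smul_induction_on hv' (fun c hc y _ ↦ ?_) fun x y hx hy ↦ by
      rw [map_add, hx, hy, add_zero]
    rw [map_smul]
    obtain ⟨s, hs⟩ := Ideal.Quotient.mk_surjective (Θ i y)
    rw [← hs, Algebra.smul_def]
    change Ideal.Quotient.mk J c * _ = 0
    rw [Ideal.Quotient.eq_zero_iff_mem.mpr hc, zero_mul]
  have hspan : Submodule.span S (Set.range fun i ↦ (1 : S) ⊗ₜ[A] b i) ⊔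
      (J.map (algebraMap S (S ⊗[A] B))).restrictScalars S = ⊤ := by
    rw [eq_top_iff]
    rintro v -
    induction v with
    | zero => exact zero_mem _
    | add x y hx hy => exact add_mem hx hy
    | tmul s x =>
      have hx : x ∈ Submodule.span A (Set.range b) ⊔ I • (⊤ : Submodule A B) := by rw [h1]; trivial
      obtain ⟨u, hu, v, hv, rfl⟩ := Submodule.mem_sup.mp hx
      rw [tmul_add]
      clear hx
      refine Submodule.add_mem_sup ?_ ?_
      · induction hu using Submodule.span_induction with
        | mem x hx =>
          obtain ⟨i, rfl⟩ := hx
          have : s ⊗ₜ[A] b i = s • ((1 : S) ⊗ₜ[A] b i) := by simp [smul_tmul']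
          rw [this]
          exact Submodule.smul_mem _ _ (Submodule.subset_span ⟨i, rfl⟩)
        | zero => simp
        | add x y _ _ hx hy => rw [tmul_add]; exact add_mem hx hy
        | smul a x _ hx =>
          rw [tmul_smul, ← algebraMap_smul S a]
          exact Submodule.smul_mem _ _ hx
      · refine Submodule.smul_induction_on hv (fun c hc y _ ↦ ?_) fun x y hx hy ↦ by
          rw [tmul_add]; exact add_mem hx hy
        have : s ⊗ₜ[A] (c • y) = algebraMap S (S ⊗[A] B) (algebraMap A S c) * (s ⊗ₜ y) := by
          rw [← Algebra.smul_def, tmul_smul, algebraMap_smul]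
        rw [this]
        exact Ideal.mul_mem_right _ _ (Ideal.mem_map_of_mem _ (hIJ c hc))
  have hu' : u ∈ Submodule.span S (Set.range fun i ↦ (1 : S) ⊗ₜ[A] b i) ⊔
      (J.map (algebraMap S (S ⊗[A] B))).restrictScalars S := by rw [hspan]; trivial
  obtain ⟨v, hv, w, hw, rfl⟩ := Submodule.mem_sup.mp hu'
  obtain ⟨F, rfl⟩ := Finsupp.mem_span_range_iff_exists_finsupp.mp hv
  have hF : ∀ i, z * F i ∈ J := by
    intro i
    have h3 : z • F.sum (fun i a ↦ a • (1 : S) ⊗ₜ[A] b i) ∈ J.map (algebraMap S (S ⊗[A] B)) := by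
      rw [smul_add] at hu
      have : z • w ∈ J.map (algebraMap S (S ⊗[A] B)) := Submodule.smul_of_tower_mem _ _ hw
      exact (Submodule.add_mem_iff_left _ this).mp hu
    have h4 := hΘJ i _ h3
    rw [Finsupp.sum, Finset.smul_sum, map_sum] at h4
    have h5 : ∀ j ∈ F.support, Θ i (z • F j • (1 : S) ⊗ₜ[A] b j) =
        if j = i then Ideal.Quotient.mk J (z * F j) else 0 := by
      intro j _
      rw [smul_smul, smul_tmul', smul_eq_mul, mul_one, hΘb]
    rw [Finset.sum_congr rfl h5, Finset.sum_ite_eq'] at h4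
    split_ifs at h4 with h6
    · exact Ideal.Quotient.eq_zero_iff_mem.mp h4
    · rw [Finsupp.notMem_support_iff.mp h6]; simp
  refine add_mem (Ideal.sum_mem _ fun i _ ↦ ?_) ?_
  · change F i • ((1 : S) ⊗ₜ[A] b i) ∈ _
    rw [Algebra.smul_def]
    exact Ideal.mul_mem_right _ _ (Ideal.mem_map_of_mem _ (hz _ (hF i)))
  · exact Ideal.map_mono (fun s hs ↦ hz s (J.mul_mem_left _ hs)) hw

/-- If a prime contracts to zero along an integral extension, then one of its powers is killed by
an element outside of it. -/
theorem Ideal.exists_notMem_mul_pow_eq_zero {S T : Type*} [CommRing S] [IsDomain S] [CommRing T]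
    [IsNoetherianRing T] [Algebra S T] [Algebra.IsIntegral S T] (P : Ideal T) [hP : P.IsPrime]
    (h : P.comap (algebraMap S T) = ⊥) :
    ∃ c ∉ P, ∃ M : ℕ, ∀ x ∈ P ^ M, c * x = 0 := by
  classical
  have hmin : P ∈ (⊥ : Ideal T).minimalPrimes := by
    refine ⟨⟨hP, bot_le⟩, fun Q hQ hQP ↦ ?_⟩
    have := hQ.1
    by_contra! hPQ
    obtain ⟨x, hxP, hxQ⟩ := SetLike.not_le_iff_exists.mp hPQ
    have := Ideal.comap_lt_comap_of_integral_mem_sdiff (R := S) hQP ⟨hxP, hxQ⟩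
      (Algebra.IsIntegral.isIntegral x)
    rw [h] at this
    exact not_lt_bot this
  obtain ⟨s, hs⟩ := (isNoetherianRing_iff_ideal_fg T).mp inferInstance P
  have : ∀ x : T, ∃ y ∉ P, ∃ n : ℕ, x ∈ P → y * x ^ n = 0 := by
    intro x
    by_cases hx : x ∈ P
    · have h1 := IsLocalization.AtPrime.radical_map_of_mem_minimalPrimes
        (Localization.AtPrime P) P _ hmin
      have h2 : algebraMap T (Localization.AtPrime P) x ∈
          IsLocalRing.maximalIdeal (Localization.AtPrime P) :=
        (IsLocalization.AtPrime.to_map_mem_maximal_iff _ P x).mpr hx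
      rw [← Localization.AtPrime.map_eq_maximalIdeal, ← h1, Ideal.map_bot] at h2
      obtain ⟨n, hn⟩ := h2
      rw [Ideal.mem_bot, ← map_pow, IsLocalization.map_eq_zero_iff P.primeCompl] at hn
      obtain ⟨y, hy⟩ := hn
      exact ⟨y, y.2, n, fun _ ↦ hy⟩
    · exact ⟨1, P.one_notMem, 0, fun h ↦ (hx h).elim⟩
  choose y hy n hn using this
  let c := ∏ x ∈ s, y x
  have hc : c ∉ P := by
    intro h
    obtain ⟨x, -, hx⟩ := (Ideal.IsPrime.prod_mem_iff).mp h
    exact hy x hx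
  have hrad : P ≤ (Submodule.colon (⊥ : Ideal T) {c}).radical := by
    conv_lhs => rw [← hs]
    rw [Ideal.span_le]
    intro x hx
    refine ⟨n x, Submodule.mem_colon_singleton.mpr ?_⟩
    rw [smul_eq_mul, mul_comm, Submodule.mem_bot]
    change (∏ x ∈ s, y x) * _ = 0
    rw [← Finset.prod_erase_mul _ _ hx, mul_assoc,
      hn x (hs ▸ Ideal.subset_span hx), mul_zero]
  obtain ⟨M, hM⟩ := Ideal.exists_pow_le_of_le_radical_of_fg hrad
    ((isNoetherianRing_iff_ideal_fg T).mp inferInstance P)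
  refine ⟨c, hc, M, fun x hx ↦ ?_⟩
  have := Submodule.mem_colon_singleton.mp (hM hx)
  rwa [smul_eq_mul, mul_comm] at this

theorem IsSOP.exists_finite_injective {S : Type*} [CommRing S] [IsLocalRing S] [IsNoetherianRing S]
    [IsAdicComplete (maximalIdeal S) S] {n : ℕ} {w : Fin n → S} (hw : IsSOP S w)
    (s : ResidueField S →+* S) (hs : (residue S).comp s = RingHom.id _) :
    ∃ g : MvPowerSeries (Fin n) (ResidueField S) →+* S,
      g.Finite ∧ Function.Injective g ∧ (∀ i, g (.X i) = w i) ∧ ∀ a, g (.C a) = s a := by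
  obtain ⟨g, hC, hX⟩ := MvPowerSeries.exists_evalHom (maximalIdeal S) s w hw.2.1
  have hfin : g.Finite := by
    refine MvPowerSeries.finite_of_isSOP g (fun a ↦ ⟨a, ?_⟩) ?_
    · simpa [hC] using DFunLike.congr_fun hs a
    · simpa only [hX] using hw.2.2
  have : IsDomain (MvPowerSeries (Fin n) (ResidueField S)) := NoZeroDivisors.to_isDomain _
  exact ⟨g, hfin, g.injective_of_finite_of_ringKrullDim_le hfin
    (MvPowerSeries.ringKrullDim_le n) hw.1.le, hX, hC⟩

theorem MvPowerSeries.mem_span_X_pow_update {ι k : Type*} [Fintype ι] [DecidableEq ι] [CommRing k]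
    (a : ι → ℕ) (j : ι) (N b : ℕ) (h : MvPowerSeries ι k)
    (hh : X j ^ b * h ∈ Ideal.span (Set.range fun i ↦
      (X i : MvPowerSeries ι k) ^ Function.update a j (N + b) i)) :
    h ∈ Ideal.span (Set.range fun i ↦ (X i : MvPowerSeries ι k) ^ Function.update a j N i) := by
  rw [← Set.image_univ, ← Finset.coe_univ, mem_span_X_pow_iff] at hh ⊢
  intro α hα
  have := hh (α + Finsupp.single j b) fun i hi ↦ by
    rcases eq_or_ne i j with rfl | hij
    · simpa using hα i hi
    · simpa [hij, Finsupp.single_eq_of_ne hij] using hα i hi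
  rwa [X_pow_eq, add_comm α, coeff_add_monomial_mul, one_mul] at this

theorem IsSOP.exists_mul_mem_span_pow_update {S : Type*} [CommRing S] [IsDomain S] [IsLocalRing S]
    [IsNoetherianRing S] [IsAdicComplete (maximalIdeal S) S] (p : ℕ) [Fact p.Prime] [CharP S p]
    {n : ℕ} {w : Fin n → S} (hw : IsSOP S w) :
    ∃ d : S, d ≠ 0 ∧ ∀ (a : Fin n → ℕ) (j : Fin n) (N b : ℕ) (s : S),
      w j ^ b * s ∈ Ideal.span (Set.range fun i ↦ w i ^ Function.update a j (N + b) i) →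
      d * s ∈ Ideal.span (Set.range fun i ↦ w i ^ Function.update a j N i) := by
  obtain ⟨s, hs⟩ := exists_coefficient_field p S
  obtain ⟨g, hfin, hinj, hX, -⟩ := hw.exists_finite_injective s hs
  algebraize [g]
  have : IsDomain (MvPowerSeries (Fin n) (ResidueField S)) := NoZeroDivisors.to_isDomain _
  obtain ⟨d, hd, h⟩ := exists_smul_mem_map_of_smul_mem_map
    (D := MvPowerSeries (Fin n) (ResidueField S)) (S := S)
  have hmap : ∀ a : Fin n → ℕ, (Ideal.span (Set.range fun i ↦
      (MvPowerSeries.X i : MvPowerSeries (Fin n) (ResidueField S)) ^ a i)).map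
      (algebraMap _ S) = Ideal.span (Set.range fun i ↦ w i ^ a i) := by
    intro a
    rw [Ideal.map_span, ← Set.range_comp]
    congr 2
    ext i
    change g (MvPowerSeries.X i ^ a i) = _
    rw [map_pow, hX]
  refine ⟨g d, (map_ne_zero_iff g hinj).mpr hd, fun a j N b s hs ↦ ?_⟩
  have := h (MvPowerSeries.X j ^ b) _ _
    (fun x hx ↦ MvPowerSeries.mem_span_X_pow_update a j N b x hx) s
  rw [hmap, hmap, Algebra.smul_def, Algebra.smul_def] at this
  refine this ?_
  change g (MvPowerSeries.X j ^ b) * s ∈ _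
  rwa [map_pow, hX]

theorem IsSOP.exists_pow_le_span {S : Type*} [CommRing S] [IsLocalRing S] [IsNoetherianRing S]
    {n : ℕ} {w : Fin n → S} (hw : IsSOP S w) (a : Fin n → ℕ) :
    ∃ N, maximalIdeal S ^ N ≤ Ideal.span (Set.range fun i ↦ w i ^ a i) := by
  refine Ideal.exists_pow_le_of_le_radical_of_fg ?_
    ((isNoetherianRing_iff_ideal_fg S).mp inferInstance _)
  rw [← hw.2.2, Ideal.radical_le_radical_iff, Ideal.span_le]
  rintro _ ⟨i, rfl⟩
  exact ⟨a i, Ideal.subset_span ⟨i, rfl⟩⟩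

theorem MonReg.exists_smul_mem_span_pow_update {k ι B S : Type*} [Field k] [Fintype ι] [CommRing B]
    [Algebra (MvPowerSeries ι k) B] [CommRing S] [IsDomain S] [IsLocalRing S]
    [IsNoetherianRing S] [IsAdicComplete (maximalIdeal S) S] (p : ℕ) [Fact p.Prime] [CharP S p]
    [Algebra (MvPowerSeries ι k) S]
    (hy : MonReg fun i : ι ↦ algebraMap (MvPowerSeries ι k) B (MvPowerSeries.X i))
    (hl : ∀ i, algebraMap (MvPowerSeries ι k) S (MvPowerSeries.X i) ∈ maximalIdeal S)
    {n : ℕ} {w : Fin n → S} (hw : IsSOP S w) :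
    ∃ d : S, d ≠ 0 ∧ ∀ (a : Fin n → ℕ) (j : Fin n) (N b : ℕ) (u : S ⊗[MvPowerSeries ι k] B),
      (w j ^ b) • u ∈ (Ideal.span (Set.range fun i ↦ w i ^ Function.update a j (N + b) i)).map
        (algebraMap S (S ⊗[MvPowerSeries ι k] B)) →
      d • u ∈ (Ideal.span (Set.range fun i ↦ w i ^ Function.update a j N i)).map
        (algebraMap S (S ⊗[MvPowerSeries ι k] B)) := by
  obtain ⟨d, hd, h⟩ := hw.exists_mul_mem_span_pow_update p
  refine ⟨d, hd, fun a j N b u hu ↦ ?_⟩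
  set J := Ideal.span (Set.range fun i ↦ w i ^ Function.update a j (N + b) i)
  set J' := Ideal.span (Set.range fun i ↦ w i ^ Function.update a j N i)
  obtain ⟨M, hM⟩ := hw.exists_pow_le_span (Function.update a j (N + b))
  have h1 := hy.mem_map_of_smul_mem_map J (J'.colon {d}) M
    (fun i ↦ hM (Ideal.pow_mem_pow (hl i) M)) (w j ^ b)
    (fun s hs ↦ Submodule.mem_colon_singleton.mpr (by
      rw [smul_eq_mul, mul_comm]; exact h a j N b s hs)) u hu
  rw [Algebra.smul_def]
  refine Submodule.span_induction (p := fun x _ ↦ algebraMap S (S ⊗[MvPowerSeries ι k] B) d * x ∈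
    J'.map (algebraMap S (S ⊗[MvPowerSeries ι k] B))) ?_ ?_ ?_ ?_ h1
  · rintro _ ⟨s, hs, rfl⟩
    rw [← map_mul, mul_comm]
    exact Ideal.mem_map_of_mem _ (Submodule.mem_colon_singleton.mp hs)
  · simp
  · intro x y _ _ hx hy
    rw [mul_add]; exact add_mem hx hy
  · intro c x _ hx
    rw [smul_eq_mul, mul_left_comm]
    exact Ideal.mul_mem_left _ _ hx

theorem Ideal.pow_expChar_pow_mem_span {U ι : Type*} [CommRing U] (p : ℕ) [ExpChar U p]
    {f : ι → U} {s : Set ι} {x : U} (hx : x ∈ span (f '' s)) (e : ℕ) :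
    x ^ p ^ e ∈ span ((fun i ↦ f i ^ p ^ e) '' s) := by
  have := Ideal.mem_map_of_mem (iterateFrobenius U p e) hx
  rwa [Ideal.map_span, Set.image_image] at this

/-- Reducing modulo the extension of a prime ideal, some power of which is killed by `c`, preserves
colon-capturing up to a fixed multiplier after passing to Frobenius powers. -/
theorem exists_forall_mul_pow_mem_map_quotient {S T U : Type*} [CommRing S] [CommRing T]
    [CommRing U] [Algebra S T] [Algebra S U] (p : ℕ) [Fact p.Prime] [CharP U p] (τ : T →ₐ[S] U)
    (π : T →ₐ[S] S) {c : T} {M : ℕ} (hc : ∀ x ∈ RingHom.ker π ^ M, c * x = 0)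
    {n : ℕ} {w : Fin n → S} {d : S}
    (hd : ∀ (a : Fin n → ℕ) (j : Fin n) (N b : ℕ) (u : U),
      (w j ^ b) • u ∈ (Ideal.span (Set.range fun i ↦ w i ^ Function.update a j (N + b) i)).map
        (algebraMap S U) →
      d • u ∈ (Ideal.span (Set.range fun i ↦ w i ^ Function.update a j N i)).map
        (algebraMap S U)) :
    ∃ e₀ : ℕ, ∀ (a : Fin n → ℕ) (j : Fin n) (t : U ⧸ (RingHom.ker π).map τ),
      algebraMap S (U ⧸ (RingHom.ker π).map τ) (w j) ^ a j * t ∈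
        Ideal.span ((fun i ↦ algebraMap S (U ⧸ (RingHom.ker π).map τ) (w i) ^ a i) '' {i | i ≠ j}) →
      ∀ e ≥ e₀, ∀ N : ℕ, algebraMap S (U ⧸ (RingHom.ker π).map τ) (d * π c) * t ^ p ^ e ∈
        (Ideal.span (Set.range fun i ↦ w i ^ Function.update (fun i ↦ p ^ e * a i) j N i)).map
          (algebraMap S (U ⧸ (RingHom.ker π).map τ)) := by
  set P := RingHom.ker π
  set G := U ⧸ P.map τ
  let q : U →ₐ[S] G := Ideal.Quotient.mkₐ S (P.map τ)
  have hq : ∀ s, algebraMap S G s = q (algebraMap S U s) := fun s ↦ (q.commutes s).symm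
  refine ⟨M, fun a j t ht e he N ↦ ?_⟩
  obtain ⟨u, rfl⟩ := Ideal.Quotient.mk_surjective t
  change _ * q u ∈ _ at ht
  change _ * q u ^ _ ∈ _
  have h1 : q (algebraMap S U (w j) ^ a j * u) ∈
      (Ideal.span ((fun i ↦ algebraMap S U (w i) ^ a i) '' {i | i ≠ j})).map q := by
    rw [Ideal.map_span, Set.image_image]
    simpa only [map_mul, map_pow, ← hq] using ht
  obtain ⟨v, hv, hvq⟩ := (Ideal.mem_map_iff_of_surjective q Ideal.Quotient.mk_surjective).mp h1
  have hπ : algebraMap S U (w j) ^ a j * u - v ∈ P.map τ :=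
    Ideal.Quotient.eq.mp hvq.symm
  have hM : M ≤ p ^ e := he.trans (Nat.lt_pow_self (Fact.out : p.Prime).one_lt).le
  have h2 : τ c * (algebraMap S U (w j) ^ a j * u - v) ^ p ^ e = 0 := by
    have : (algebraMap S U (w j) ^ a j * u - v) ^ p ^ e ∈ (P ^ M).map τ := by
      rw [Ideal.map_pow]
      exact Ideal.pow_le_pow_right hM (Ideal.pow_mem_pow hπ _)
    refine Submodule.span_induction (p := fun x _ ↦ τ c * x = 0) ?_ ?_ ?_ ?_ this
    · rintro _ ⟨x, hx, rfl⟩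
      rw [← map_mul, hc x hx, map_zero]
    · simp
    · intro x y _ _ hx hy; rw [mul_add, hx, hy, add_zero]
    · intro r x _ hx; rw [smul_eq_mul, mul_left_comm, hx, mul_zero]
  rw [sub_pow_char_pow, mul_sub, sub_eq_zero] at h2
  have h3 := Ideal.pow_expChar_pow_mem_span p hv e
  have h4 : (w j ^ (p ^ e * a j)) • (τ c * u ^ p ^ e) ∈ (Ideal.span (Set.range fun i ↦
      w i ^ Function.update (fun i ↦ p ^ e * a i) j (N + p ^ e * a j) i)).map (algebraMap S U) := by
    have : (w j ^ (p ^ e * a j)) • (τ c * u ^ p ^ e) = τ c * v ^ p ^ e := by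
      rw [← h2, Algebra.smul_def, map_pow]; ring
    rw [this]
    refine Ideal.mul_mem_left _ _ (Ideal.span_le.mpr ?_ h3)
    rintro _ ⟨i, hi, rfl⟩
    have : algebraMap S U (w i ^ Function.update (fun i ↦ p ^ e * a i) j (N + p ^ e * a j) i) ∈
        (Ideal.span (Set.range fun i ↦ w i ^ Function.update (fun i ↦ p ^ e * a i) j
          (N + p ^ e * a j) i)).map (algebraMap S U) :=
      Ideal.mem_map_of_mem (algebraMap S U) (Ideal.subset_span ⟨i, rfl⟩)
    rw [Function.update_of_ne hi, map_pow] at this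
    change (algebraMap S U (w i) ^ a i) ^ p ^ e ∈ _
    rw [← pow_mul, mul_comm (a i)]
    exact this
  have h5 := Ideal.mem_map_of_mem q (hd _ j N _ _ h4)
  have h6 : (Ideal.span (Set.range fun i ↦
      w i ^ Function.update (fun i ↦ p ^ e * a i) j N i)).map (algebraMap S G) =
      ((Ideal.span (Set.range fun i ↦
      w i ^ Function.update (fun i ↦ p ^ e * a i) j N i)).map (algebraMap S U)).map q := by
    change _ = Ideal.map (q : U →+* G) _
    rw [Ideal.map_map, q.comp_algebraMap]
  have h7 : q (τ c) = algebraMap S G (π c) := by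
    rw [hq, ← τ.commutes]
    refine Ideal.Quotient.eq.mpr ?_
    rw [← map_sub]
    refine Ideal.mem_map_of_mem _ ?_
    rw [RingHom.mem_ker, map_sub, AlgHom.commutes]
    simp
  rw [h6]
  rwa [map_smul, Algebra.smul_def, map_mul, map_pow, h7, ← mul_assoc, ← map_mul] at h5

theorem exists_isSOP (S : Type*) [CommRing S] [IsLocalRing S] [IsNoetherianRing S] :
    ∃ (n : ℕ) (w : Fin n → S), IsSOP S w := by
  obtain ⟨s, hs, hcard⟩ := (maximalIdeal S).exists_finset_card_eq_height_of_isNoetherianRing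
  have hle : Ideal.span (s : Set S) ≤ maximalIdeal S := hs.1.2
  have hr : Set.range (fun i ↦ (s.equivFin.symm i : S)) = s := by
    ext x
    constructor
    · rintro ⟨i, rfl⟩; exact (s.equivFin.symm i).2
    · intro hx; exact ⟨s.equivFin ⟨x, hx⟩, by simp⟩
  refine ⟨s.card, fun i ↦ s.equivFin.symm i, ?_, fun i ↦ hle (Ideal.subset_span ?_), ?_⟩
  · rw [← maximalIdeal_height_eq_ringKrullDim, ← hcard]; rfl
  · exact (s.equivFin.symm i).2
  · rw [hr]
    refine le_antisymm ((Ideal.IsPrime.radical_le_iff inferInstance).mpr hle) ?_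
    rw [Ideal.radical_eq_sInf]
    refine le_sInf fun J ⟨hJ, hJp⟩ ↦ hs.2 ⟨hJp, hJ⟩ (le_maximalIdeal hJp.ne_top)

theorem MvPowerSeries.le_order_of_mem_maximalIdeal_pow {σ k : Type*} [Field k] (N : ℕ)
    {h : MvPowerSeries σ k} (hh : h ∈ maximalIdeal (MvPowerSeries σ k) ^ N) :
    (N : ℕ∞) ≤ h.order := by
  induction N generalizing h with
  | zero => simp
  | succ N ih =>
    rw [pow_succ] at hh
    refine Submodule.mul_induction_on hh (fun x hx y hy ↦ ?_)
      fun x y hx hy ↦ (le_min hx hy).trans min_order_le_add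
    refine le_trans ?_ le_order_mul
    push_cast
    refine add_le_add (ih hx) (one_le_order_iff_constCoeff_eq_zero.mpr ?_)
    by_contra hne
    exact hy (isUnit_iff_constantCoeff.mpr (isUnit_iff_ne_zero.mpr hne))

theorem exists_smul_notMem_pow_smul_top {R M : Type*} [CommRing R] [IsNoetherianRing R]
    [AddCommGroup M] [Module R M] [Module.Finite R M] (P : Ideal R) [hP : P.IsPrime] (θ : M)
    (hθ : ∀ h ∉ P, h • θ ≠ 0) :
    ∃ N : ℕ, ∀ h ∉ P, h • θ ∉ P ^ N • (⊤ : Submodule R M) := by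
  let R' := Localization.AtPrime P
  let M' := LocalizedModule P.primeCompl M
  let f : M →ₗ[R] M' := LocalizedModule.mkLinearMap P.primeCompl M
  have hne : f θ ≠ 0 := by
    intro h0
    obtain ⟨c, hc⟩ := (IsLocalizedModule.eq_zero_iff P.primeCompl f).mp h0
    exact hθ c c.2 hc
  have : Module.Finite R' M' := Module.Finite.of_isLocalizedModule P.primeCompl f
  have hK := (maximalIdeal R').iInf_pow_smul_eq_bot_of_isLocalRing (M := M')
    (Ideal.IsPrime.ne_top inferInstance)
  have : ∃ N : ℕ, f θ ∉ maximalIdeal R' ^ N • (⊤ : Submodule R' M') := by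
    by_contra! hc
    exact hne ((Submodule.mem_bot R').mp (hK ▸ (Submodule.mem_iInf _).mpr hc))
  obtain ⟨N, hN⟩ := this
  refine ⟨N, fun h hh hmem ↦ hN ?_⟩
  have h1 : f (h • θ) ∈ maximalIdeal R' ^ N • (⊤ : Submodule R' M') := by
    refine Submodule.smul_induction_on hmem (fun r hr x _ ↦ ?_) fun x y hx hy ↦ by
      rw [map_add]; exact add_mem hx hy
    rw [map_smul, ← algebraMap_smul R' r]
    refine Submodule.smul_mem_smul ?_ trivial
    rw [← Localization.AtPrime.map_eq_maximalIdeal, ← Ideal.map_pow]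
    exact Ideal.mem_map_of_mem _ hr
  rw [map_smul, ← algebraMap_smul R' h] at h1
  have hu : IsUnit (algebraMap R R' h) := IsLocalization.map_units R' (⟨h, hh⟩ : P.primeCompl)
  exact (Submodule.smul_mem_iff_of_isUnit _ hu).mp h1

theorem MvPowerSeries.order_pow_eq {σ k : Type*} [Field k] (f : MvPowerSeries σ k) (n : ℕ) :
    (f ^ n).order = n * f.order := by
  induction n with
  | zero => simp [order]
  | succ n ih => rw [pow_succ, order_mul, ih]; push_cast; ring

/-- A nonzero functional which kills a power of `P` bounds the order of elements of the base modulo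
`P`. -/
theorem MvPowerSeries.exists_order_bound {σ k : Type*} [Field k] {S U : Type*} [CommRing S]
    [CommRing U] [Algebra S U] (g : MvPowerSeries σ k →+* S) (m : Ideal S) (a : ℕ)
    (hm : m ^ a ≤ (maximalIdeal (MvPowerSeries σ k)).map g) (P : Ideal U) (M : ℕ)
    (Θ : U →+ MvPowerSeries σ k) (hΘ : ∀ d u, Θ (algebraMap S U (g d) * u) = d * Θ u)
    (hP : ∀ u ∈ P ^ M, Θ u = 0) (h1 : Θ 1 ≠ 0) (δ : MvPowerSeries σ k) (hδ : δ ≠ 0) :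
    ∃ ρ : ℕ, ∀ u Q : ℕ, ρ * u < Q →
      algebraMap S (U ⧸ P) (g δ ^ u) ∉ (m ^ Q).map (algebraMap S (U ⧸ P)) := by
  obtain ⟨o, ho⟩ := ENat.ne_top_iff_exists.mp (mt order_eq_top_iff.mp hδ)
  obtain ⟨o1, ho1⟩ := ENat.ne_top_iff_exists.mp (mt order_eq_top_iff.mp h1)
  refine ⟨a * o, fun u Q hQ hmem ↦ ?_⟩
  have hmem' : algebraMap S U (g δ ^ u) ∈ (m ^ Q).map (algebraMap S U) ⊔ P := by
    have h2 : (m ^ Q).map (algebraMap S (U ⧸ P)) =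
        ((m ^ Q).map (algebraMap S U)).map (Ideal.Quotient.mk P) := by
      rw [Ideal.map_map]; rfl
    rw [h2] at hmem
    obtain ⟨v, hv, hvq⟩ :=
      (Ideal.mem_map_iff_of_surjective _ Ideal.Quotient.mk_surjective).mp hmem
    have h3 : algebraMap S U (g δ ^ u) - v ∈ P := Ideal.Quotient.eq.mp hvq.symm
    rw [← add_sub_cancel v (algebraMap S U (g δ ^ u))]
    exact Submodule.add_mem_sup hv h3
  have hI : ∀ N : ℕ, ∀ y ∈ (m ^ (a * N)).map (algebraMap S U), (N : ℕ∞) ≤ (Θ y).order := by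
    intro N y hy
    refine le_order_of_mem_maximalIdeal_pow N ?_
    have h4 : (m ^ (a * N)).map (algebraMap S U) ≤
        (maximalIdeal (MvPowerSeries σ k) ^ N).map ((algebraMap S U).comp g) := by
      rw [← Ideal.map_map, pow_mul, Ideal.map_pow g]
      exact Ideal.map_mono (Ideal.pow_right_mono hm N)
    refine Submodule.span_induction (p := fun x _ ↦ ∀ r, Θ (r * x) ∈
      maximalIdeal (MvPowerSeries σ k) ^ N) ?_ ?_ ?_ ?_ (h4 hy) 1 |> (by rwa [one_mul] at ·)
    · rintro _ ⟨d, hd, rfl⟩ r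
      rw [mul_comm, RingHom.comp_apply, hΘ]
      exact Ideal.mul_mem_right _ _ hd
    · simp
    · intro x y _ _ hx hy r; rw [mul_add, map_add]; exact add_mem (hx r) (hy r)
    · intro c x _ hx r; rw [smul_eq_mul, ← mul_assoc]; exact hx _
  have key : ∀ N : ℕ, Q * N ≤ u * (a * N + M) * o + o1 := by
    intro N
    have h5 : algebraMap S U (g δ ^ u) ^ (a * N + M) ∈
        (m ^ (a * (Q * N))).map (algebraMap S U) ⊔ P ^ M := by
      have := Ideal.sup_pow_add_le_pow_sup_pow (Ideal.pow_mem_pow hmem' (a * N + M))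
      rwa [← Ideal.map_pow, ← pow_mul, show Q * (a * N) = a * (Q * N) by ring] at this
    obtain ⟨y, hy, z, hz, hyz⟩ := Submodule.mem_sup.mp h5
    have h6 : Θ y = δ ^ (u * (a * N + M)) * Θ 1 := by
      have h8 : algebraMap S U (g (δ ^ (u * (a * N + M)))) = y + z := by
        rw [hyz, map_pow g, pow_mul, map_pow (algebraMap S U) _ (a * N + M)]
      rw [← hΘ, mul_one, h8, map_add, hP z hz, add_zero]
    have h7 := hI _ y hy
    rw [h6, order_mul, order_pow_eq, ← ho, ← ho1] at h7
    exact_mod_cast h7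
  have := key (u * M * o + o1 + 1)
  nlinarith [Nat.zero_le (u * M * o + o1)]

/-- If `1 ∈ U` has an image with zero annihilator in a finite module over `R'`, then nonzero
elements of `S = R' ⧸ P` have finite order on `U ⧸ P U`. -/
theorem exists_forall_pow_notMem_map_pow {S R' U Ω : Type*} [CommRing S] [IsDomain S]
    [IsLocalRing S] [IsNoetherianRing S] [IsAdicComplete (maximalIdeal S) S] (p : ℕ)
    [Fact p.Prime] [CharP S p] [CommRing R'] [IsNoetherianRing R'] [Algebra S R'] [CommRing U]
    [Algebra S U] [Algebra R' U] [IsScalarTower S R' U] [AddCommGroup Ω] [Module R' Ω]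
    [Module.Finite R' Ω] (π : R' →ₐ[S] S) (ω : U →ₗ[R'] Ω)
    (hω : ∀ g : R', g ≠ 0 → g • ω 1 ≠ 0) (c : S) (hc : c ≠ 0) :
    ∃ ρ : ℕ, ∀ u Q : ℕ, ρ * u < Q →
      algebraMap S (U ⧸ (RingHom.ker π).map (algebraMap R' U)) (c ^ u) ∉
        (maximalIdeal S ^ Q).map
          (algebraMap S (U ⧸ (RingHom.ker π).map (algebraMap R' U))) := by
  set P := RingHom.ker π with hPdef
  have hPp : P.IsPrime := RingHom.ker_isPrime _
  obtain ⟨M, hM⟩ := exists_smul_notMem_pow_smul_top P (ω 1)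
    fun h hh ↦ hω h fun h0 ↦ hh (h0 ▸ P.zero_mem)
  obtain ⟨n, w, hw⟩ := exists_isSOP S
  obtain ⟨s, hs⟩ := exists_coefficient_field p S
  obtain ⟨g, hfin, hinj, hX, -⟩ := hw.exists_finite_injective s hs
  have : IsDomain (MvPowerSeries (Fin n) (ResidueField S)) := NoZeroDivisors.to_isDomain _
  let : Algebra (MvPowerSeries (Fin n) (ResidueField S)) S := g.toAlgebra
  have : Module.Finite (MvPowerSeries (Fin n) (ResidueField S)) S := hfin
  replace hM : ∀ h ∉ P, h • ω 1 ∉ P ^ (M + 1) • (⊤ : Submodule R' Ω) := fun h hh hmem ↦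
    hM h hh (Submodule.smul_mono_left (Ideal.pow_le_pow_right M.le_succ) hmem)
  obtain ⟨M, hM0, hM⟩ : ∃ M ≠ 0, ∀ h ∉ P, h • ω 1 ∉ P ^ M • (⊤ : Submodule R' Ω) :=
    ⟨_, M.succ_ne_zero, hM⟩
  have hfinS : Module.Finite S (R' ⧸ P ^ M) := by
    let f : (R' ⧸ P ^ M) →ₐ[S] S :=
      Ideal.Quotient.liftₐ (P ^ M) π fun x hx ↦
        RingHom.mem_ker.mp (Ideal.pow_le_self hM0 hx)
    refine Module.finite_of_surjective_of_ker_le_nilradical f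
      (fun x ↦ ⟨algebraMap S _ x, f.commutes x⟩) (fun x hx ↦ ?_)
      ((isNoetherianRing_iff_ideal_fg _).mp inferInstance _)
    obtain ⟨y, rfl⟩ := Ideal.Quotient.mk_surjective x
    exact ⟨M, Ideal.Quotient.eq_zero_iff_mem.mpr (Ideal.pow_mem_pow (I := P) hx M)⟩
  let W := Ω ⧸ (P ^ M • (⊤ : Submodule R' Ω))
  let : Module S W := Module.compHom W (algebraMap S R')
  have : IsScalarTower S R' W := ⟨fun a b x ↦ by
    rw [Algebra.smul_def, mul_smul]; rfl⟩
  have : Module.Finite (R' ⧸ P ^ M) W := Module.Finite.of_restrictScalars_finite R' _ _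
  have : IsScalarTower S (R' ⧸ P ^ M) W := ⟨fun a b x ↦ by
    rw [Algebra.smul_def, mul_smul]; rfl⟩
  have : Module.Finite S W := Module.Finite.trans (R' ⧸ P ^ M) W
  let : Module (MvPowerSeries (Fin n) (ResidueField S)) W := Module.compHom W g
  have : IsScalarTower (MvPowerSeries (Fin n) (ResidueField S)) S W := ⟨fun a b x ↦ by
    rw [Algebra.smul_def, mul_smul]; rfl⟩
  have : Module.Finite (MvPowerSeries (Fin n) (ResidueField S)) W := Module.Finite.trans S W
  let mkW : Ω →ₗ[R'] W := (P ^ M • (⊤ : Submodule R' Ω)).mkQ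
  have hsm : ∀ (d : MvPowerSeries (Fin n) (ResidueField S)) (x : Ω),
      d • mkW x = mkW (algebraMap S R' (g d) • x) := fun d x ↦ (map_smul mkW _ _).symm
  obtain ⟨χ, hχ⟩ := Module.Finite.exists_dual_apply_ne_zero
    (D := MvPowerSeries (Fin n) (ResidueField S)) (mkW (ω 1)) (by
      intro d hd h0
      rw [hsm] at h0
      refine hM (algebraMap S R' (g d)) ?_ ((Submodule.Quotient.mk_eq_zero _).mp h0)
      rw [hPdef, RingHom.mem_ker, AlgHom.commutes]
      exact (map_ne_zero_iff g hinj).mpr hd)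
  obtain ⟨r, δ, hδ⟩ : ∃ (r : S) (δ : MvPowerSeries (Fin n) (ResidueField S)),
      c * r = g δ ∧ δ ≠ 0 := by
    have h := Ideal.comap_ne_bot_of_integral_mem (R := MvPowerSeries (Fin n) (ResidueField S)) hc
      (Ideal.mem_span_singleton_self c) (Algebra.IsIntegral.isIntegral c)
    obtain ⟨δ, hδ, hδ0⟩ := Submodule.exists_mem_ne_zero_of_ne_bot h
    obtain ⟨r, hr⟩ := Ideal.mem_span_singleton.mp hδ
    exact ⟨r, δ, hr.symm, hδ0⟩
  obtain ⟨a, ha⟩ : ∃ a, maximalIdeal S ^ a ≤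
      (maximalIdeal (MvPowerSeries (Fin n) (ResidueField S))).map g := by
    obtain ⟨a, ha⟩ := hw.exists_pow_le_span fun _ ↦ 1
    refine ⟨a, ha.trans (Ideal.span_le.mpr ?_)⟩
    rintro _ ⟨i, rfl⟩
    simp only [pow_one]
    rw [← hX i]
    refine Ideal.mem_map_of_mem _ ?_
    rw [MvPowerSeries.maximalIdeal_eq_span]
    exact Ideal.subset_span ⟨i, rfl⟩
  obtain ⟨ρ, hρ⟩ := MvPowerSeries.exists_order_bound g (maximalIdeal S) a ha
    (P.map (algebraMap R' U)) M
    ((χ.toAddMonoidHom.comp mkW.toAddMonoidHom).comp ω.toAddMonoidHom) (by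
      intro d u
      change χ (mkW (ω _)) = d * χ (mkW (ω u))
      refine (congrArg χ ?_).trans (map_smul χ d _)
      rw [hsm, ← map_smul ω, Algebra.smul_def, ← IsScalarTower.algebraMap_apply])
    (by
      intro u hu
      change χ (mkW (ω u)) = 0
      suffices mkW (ω u) = 0 by rw [this, map_zero]
      rw [← Ideal.map_pow] at hu
      refine (Submodule.Quotient.mk_eq_zero _).mpr ?_
      have hu' : u ∈ (P ^ M) • (⊤ : Submodule R' U) := by
        rw [Ideal.smul_top_eq_map]; exact hu
      refine Submodule.smul_induction_on hu' (fun r hr x _ ↦ ?_) fun x y hx hy ↦ by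
        rw [map_add]; exact add_mem hx hy
      rw [map_smul]
      exact Submodule.smul_mem_smul hr trivial) hχ δ hδ.2
  refine ⟨ρ, fun u Q hQ hmem ↦ hρ u Q hQ ?_⟩
  rw [← hδ.1, mul_pow, map_mul]
  exact Ideal.mul_mem_right _ _ hmem

namespace MvPowerSeries

/-- The coefficientwise application of a linear functional. -/
def mapFunctional {σ k S : Type*} [CommRing k] [CommRing S] [Algebra k S] (μ : S →ₗ[k] k) :
    MvPowerSeries σ S →ₗ[MvPowerSeries σ k] MvPowerSeries σ k where
  toFun h := fun α ↦ μ (coeff α h)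
  map_add' x y := by ext α; exact (congrArg μ (map_add _ _ _)).trans (map_add μ _ _)
  map_smul' a h := by
    classical
    ext α
    have key : ∀ m : MvPowerSeries σ k, (∀ β, coeff β m = μ (coeff β h)) →
        μ (coeff α (a • h)) = coeff α (a * m) := by
      intro m hm
      rw [Algebra.smul_def, coeff_mul, coeff_mul, map_sum]
      refine Finset.sum_congr rfl fun x _ ↦ ?_
      change μ (algebraMap k S (coeff x.1 a) * coeff x.2 h) = _
      rw [← Algebra.smul_def, map_smul, smul_eq_mul, hm]
    exact key _ fun _ ↦ rfl

/-- The contraction `S⟦X⟧ ⊗ M → M` along a functional on `S`. -/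
noncomputable def contract {σ k S : Type*} [CommRing k] [CommRing S] [Algebra k S] (M : Type*)
    [AddCommGroup M] [Module (MvPowerSeries σ k) M] (μ : S →ₗ[k] k) :
    MvPowerSeries σ S ⊗[MvPowerSeries σ k] M →ₗ[MvPowerSeries σ k] M :=
  (TensorProduct.lid _ M).toLinearMap ∘ₗ (mapFunctional μ).rTensor M

theorem contract_tmul {σ k S : Type*} [CommRing k] [CommRing S] [Algebra k S] (M : Type*)
    [AddCommGroup M] [Module (MvPowerSeries σ k) M] (μ : S →ₗ[k] k) (h : MvPowerSeries σ S)
    (x : M) : contract M μ (h ⊗ₜ x) = mapFunctional μ h • x := rfl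

theorem exists_sub_sum_mem {σ κ k S M : Type*} [Fintype σ] [CommRing k] [CommRing S]
    [Algebra k S] [AddCommGroup M] [Module (MvPowerSeries σ k) M] (b : Module.Basis κ k S) (N : ℕ)
    (g : MvPowerSeries σ S ⊗[MvPowerSeries σ k] M) :
    ∃ F₀ : Finset κ, ∀ F, F₀ ⊆ F → g - ∑ e ∈ F, C (b e) ⊗ₜ contract M (b.coord e) g ∈
      Ideal.span (Set.range fun i ↦ (X i : MvPowerSeries σ S) ^ N) •
        (⊤ : Submodule (MvPowerSeries σ S) (MvPowerSeries σ S ⊗[MvPowerSeries σ k] M)) := by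
  classical
  induction g with
  | zero => exact ⟨∅, by simp⟩
  | add x y hx hy =>
    obtain ⟨F, hF⟩ := hx
    obtain ⟨F', hF'⟩ := hy
    refine ⟨F ∪ F', fun K hK ↦ ?_⟩
    have := add_mem (hF K (Finset.union_subset_left hK)) (hF' K (Finset.union_subset_right hK))
    simp only [map_add, tmul_add, Finset.sum_add_distrib]
    rwa [sub_add_sub_comm] at this
  | tmul h x =>
    let box : Finset (σ →₀ ℕ) := Finset.Iic (Finsupp.equivFunOnFinite.symm fun _ ↦ N)
    refine ⟨box.biUnion fun α ↦ (b.repr (coeff α h)).support, fun F hF ↦ ?_⟩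
    have h1 : h - ∑ e ∈ F, (mapFunctional (b.coord e) h) • C (b e) ∈
        Ideal.span (Set.range fun i ↦ (X i : MvPowerSeries σ S) ^ N) := by
      rw [mem_span_range_X_pow_iff]
      intro α hα
      have hα' : α ∈ box := Finset.mem_Iic.mpr fun i ↦ (hα i).le
      have h2 : ∀ e, coeff α (mapFunctional (b.coord e) h • C (b e) : MvPowerSeries σ S) =
          b.repr (coeff α h) e • b e := by
        intro e
        rw [Algebra.smul_def, coeff_mul_C, Algebra.smul_def]
        rfl
      rw [map_sub, map_sum, Finset.sum_congr rfl fun e _ ↦ h2 e, sub_eq_zero]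
      conv_lhs => rw [← b.linearCombination_repr (coeff α h), Finsupp.linearCombination_apply]
      exact Finsupp.sum_of_support_subset _ ((Finset.subset_biUnion_of_mem
        (fun α ↦ (b.repr (coeff α h)).support) hα').trans hF) _ (by simp)
    have h3 : h ⊗ₜ[MvPowerSeries σ k] x - ∑ e ∈ F, C (b e) ⊗ₜ contract M (b.coord e) (h ⊗ₜ x) =
        (h - ∑ e ∈ F, (mapFunctional (b.coord e) h) • C (b e)) • (1 ⊗ₜ x) := by
      simp only [contract_tmul, ← smul_tmul, smul_tmul', smul_eq_mul, mul_one, sub_tmul, sum_tmul]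
    rw [h3]
    exact Submodule.smul_mem_smul h1 trivial

theorem eq_zero_of_contract_eq_zero {σ κ k S M : Type*} [Finite σ] [CommRing k] [CommRing S]
    [IsNoetherianRing S] [IsLocalRing S]
    [Algebra k S] [AddCommGroup M] [Module (MvPowerSeries σ k) M]
    [Module.Finite (MvPowerSeries σ k) M] (b : Module.Basis κ k S)
    (g : MvPowerSeries σ S ⊗[MvPowerSeries σ k] M)
    (h : ∀ e, contract M (b.coord e) g = 0) : g = 0 := by
  have := Fintype.ofFinite σ
  have hK := (Ideal.span (Set.range (X : σ → MvPowerSeries σ S))).iInf_pow_smul_eq_bot_of_isLocalRing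
    (M := MvPowerSeries σ S ⊗[MvPowerSeries σ k] M) (by
      intro h
      have h1 : (1 : MvPowerSeries σ S) ∈ Ideal.span (Set.range fun i ↦ X i ^ 1) := by
        simp only [pow_one, h]; trivial
      rw [mem_span_range_X_pow_iff] at h1
      simpa using h1 0 (by simp))
  refine (Submodule.mem_bot (MvPowerSeries σ S)).mp (hK ▸ (Submodule.mem_iInf _).mpr fun N ↦ ?_)
  obtain ⟨F, hF⟩ := exists_sub_sum_mem b N g
  have := hF F subset_rfl
  simp only [h, tmul_zero, Finset.sum_const_zero, sub_zero] at this
  refine Submodule.smul_mono_left ?_ this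
  rw [Ideal.span_le]
  rintro _ ⟨i, rfl⟩
  have hi : X i ∈ Ideal.span (Set.range (X : σ → MvPowerSeries σ S)) := Ideal.subset_span ⟨i, rfl⟩
  exact Ideal.pow_mem_pow hi N

theorem eq_zero_of_forall_liftBaseChange_eq_zero {σ k S R : Type*} [Finite σ] [Field k]
    [CommRing S] [IsNoetherianRing S] [IsLocalRing S] [Algebra k S] [CommRing R]
    [Algebra (MvPowerSeries σ k) R] [Module.Finite (MvPowerSeries σ k) R]
    (ψ : R →ₗ[MvPowerSeries σ k] MvPowerSeries σ k)
    (hψ : ∀ z, (∀ r, ψ (r * z) = 0) → z = 0) (g : MvPowerSeries σ S ⊗[MvPowerSeries σ k] R)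
    (hg : ∀ r : R, (Algebra.linearMap (MvPowerSeries σ k) (MvPowerSeries σ S) ∘ₗ ψ).liftBaseChange
      (MvPowerSeries σ S) (1 ⊗ₜ r * g) = 0) : g = 0 := by
  refine eq_zero_of_contract_eq_zero (Module.Basis.ofVectorSpace k S) g fun e ↦ hψ _ fun r ↦ ?_
  generalize (Module.Basis.ofVectorSpace k S).coord e = μ
  have h1 : ∀ x : MvPowerSeries σ S ⊗[MvPowerSeries σ k] R,
      ψ (r * contract R μ x) = mapFunctional μ
        ((Algebra.linearMap (MvPowerSeries σ k) (MvPowerSeries σ S) ∘ₗ ψ).liftBaseChange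
          (MvPowerSeries σ S) (1 ⊗ₜ r * x)) := by
    intro x
    induction x with
    | zero => simp
    | add x y hx hy => rw [map_add, mul_add, map_add, hx, hy, mul_add, map_add, map_add]
    | tmul h z =>
      rw [contract_tmul, Algebra.TensorProduct.tmul_mul_tmul, LinearMap.liftBaseChange_tmul,
        one_mul, mul_smul_comm, map_smul, LinearMap.comp_apply, Algebra.linearMap_apply,
        smul_eq_mul, smul_eq_mul, mul_comm h, ← Algebra.smul_def, map_smul, smul_eq_mul, mul_comm]
  rw [h1, hg, map_zero]

end MvPowerSeries

theorem exists_finite_quotient_of_linearMap {E R' M : Type*} [CommRing E] [IsNoetherianRing E]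
    [CommRing R'] [Algebra E R'] [Module.Finite E R'] [AddCommGroup M] [Module E M] [Module R' M]
    [IsScalarTower E R' M] (ψ : M →ₗ[E] E) :
    ∃ K : Submodule R' M, Module.Finite R' (M ⧸ K) ∧ ∀ u ∈ K, ∀ x : R', ψ (x • u) = 0 := by
  let K : Submodule R' M :=
    { carrier := {u | ∀ x : R', ψ (x • u) = 0}
      add_mem' := fun ha hb x ↦ by rw [smul_add, map_add, ha, hb, add_zero]
      zero_mem' := fun x ↦ by rw [smul_zero, map_zero]
      smul_mem' := fun y u hu x ↦ by rw [smul_smul]; exact hu _ }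
  refine ⟨K, ?_, fun u hu ↦ hu⟩
  obtain ⟨s, hs⟩ := Module.Finite.fg_top (R := E) (M := R')
  let Λ : M →ₗ[E] (s → E) := LinearMap.pi fun r ↦ ψ ∘ₗ Module.toModuleEnd E (S := R') M (r : R')
  have hK : LinearMap.ker Λ ≤ K.restrictScalars E := by
    intro u hu x
    have hx : x ∈ Submodule.span E (s : Set R') := hs ▸ trivial
    induction hx using Submodule.span_induction with
    | mem x hx => exact congrFun (LinearMap.mem_ker.mp hu) ⟨x, hx⟩
    | zero => rw [zero_smul, map_zero]
    | add x y _ _ hx hy => rw [add_smul, map_add, hx, hy, add_zero]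
    | smul e x _ hx => rw [smul_assoc, map_smul, hx, smul_zero]
  have h1 : Module.Finite E (M ⧸ LinearMap.ker Λ) :=
    Module.Finite.equiv Λ.quotKerEquivRange.symm
  have h2 : Module.Finite E (M ⧸ K.restrictScalars E) :=
    Module.Finite.of_surjective (Submodule.factor hK) (Submodule.factor_surjective hK)
  have h3 : Module.Finite E (M ⧸ K) :=
    Module.Finite.equiv (Submodule.Quotient.restrictScalarsEquiv E K)
  exact Module.Finite.of_restrictScalars_finite E R' _

theorem LinearMap.eq_zero_of_forall_apply_smul_eq_zero {A R B : Type*} [CommRing A] [IsDomain A]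
    [CommRing R] [IsDomain R]
    [Algebra A R] [Algebra.IsIntegral A R] [CommRing B] [Algebra A B] [Algebra R B]
    [IsScalarTower A R B] (ψ : B →ₗ[A] A) (hψ : ψ 1 ≠ 0) (z : R)
    (hz : ∀ r : R, ψ (algebraMap R B (r * z)) = 0) : z = 0 := by
  by_contra h0
  have h1 := Ideal.comap_ne_bot_of_integral_mem (R := A) (I := Ideal.span {z}) h0
    (Ideal.mem_span_singleton_self z) (Algebra.IsIntegral.isIntegral z)
  obtain ⟨a, ha, ha0⟩ := Submodule.exists_mem_ne_zero_of_ne_bot h1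
  obtain ⟨r, hr⟩ := Ideal.mem_span_singleton'.mp (Ideal.mem_comap.mp ha)
  have h2 := hz r
  rw [hr, ← IsScalarTower.algebraMap_apply, Algebra.algebraMap_eq_smul_one, map_smul,
    smul_eq_mul] at h2
  exact (mul_ne_zero ha0 hψ) h2

theorem Algebra.TensorProduct.exists_ringHom_apply_tmul {A E R S : Type*} [CommRing A] [CommRing E]
    [CommRing R] [CommRing S] [Algebra A E] [Algebra A R] (f : E →+* S) (g : R →+* S)
    (h : f.comp (algebraMap A E) = g.comp (algebraMap A R)) :
    ∃ π : E ⊗[A] R →+* S, ∀ e r, π (e ⊗ₜ r) = f e * g r := by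
  let _ : Algebra A S := (g.comp (algebraMap A R)).toAlgebra
  let f' : E →ₐ[A] S := { f with commutes' := fun a ↦ DFunLike.congr_fun h a }
  let g' : R →ₐ[A] S := { g with commutes' := fun a ↦ rfl }
  exact ⟨(Algebra.TensorProduct.productMap f' g').toRingHom,
    Algebra.TensorProduct.productMap_apply_tmul f' g'⟩

theorem exists_forall_pow_notMem_map_pow_tensorProduct {k ι R B S : Type*} [Field k] [Fintype ι]
    [CommRing R] [IsDomain R] [Algebra (MvPowerSeries ι k) R] [Module.Finite (MvPowerSeries ι k) R]
    [CommRing B] [Algebra (MvPowerSeries ι k) B] [Algebra R B]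
    [IsScalarTower (MvPowerSeries ι k) R B] [CommRing S] [IsDomain S] [IsLocalRing S]
    [IsNoetherianRing S] [IsAdicComplete (maximalIdeal S) S] (p : ℕ) [Fact p.Prime] [CharP S p]
    [Algebra R S] [Algebra k S]
    (hk : ∀ a, algebraMap k S a =
      algebraMap R S (algebraMap (MvPowerSeries ι k) R (MvPowerSeries.C a)))
    (hl : ∀ i, algebraMap R S (algebraMap (MvPowerSeries ι k) R (.X i)) ∈ maximalIdeal S)
    (ψ : B →ₗ[MvPowerSeries ι k] MvPowerSeries ι k) (hψ : ψ 1 ≠ 0) (c : S) (hc : c ≠ 0) :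
    ∃ ρ : ℕ, ∀ u Q : ℕ, ρ * u < Q → algebraMap S (S ⊗[R] B) (c ^ u) ∉
      (maximalIdeal S ^ Q).map (algebraMap S (S ⊗[R] B)) := by
  let A := MvPowerSeries ι k
  let E := MvPowerSeries ι S
  have : IsDomain A := NoZeroDivisors.to_isDomain _
  obtain ⟨ev, hevC, hevX⟩ := MvPowerSeries.exists_evalHom (maximalIdeal S) (RingHom.id S) _ hl
  have hev : ev.comp (algebraMap A E) = (algebraMap R S).comp (algebraMap A R) := by
    refine MvPowerSeries.ringHom_ext_of_isHausdorff (maximalIdeal S) (fun a ↦ ?_) (fun i ↦ ?_)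
      fun i ↦ ?_
    · rw [RingHom.comp_apply, RingHom.comp_apply, ← hk]
      change ev (MvPowerSeries.map (algebraMap k S) (.C a)) = _
      rw [MvPowerSeries.map_C, hevC, RingHom.id_apply]
    · rw [RingHom.comp_apply, RingHom.comp_apply, ← hevX]
      change ev (MvPowerSeries.map (algebraMap k S) (.X i)) = _
      rw [MvPowerSeries.map_X]
    · rw [RingHom.comp_apply]
      change ev (MvPowerSeries.map (algebraMap k S) (.X i)) ∈ _
      rw [MvPowerSeries.map_X, hevX]
      exact hl i
  let τ : E ⊗[A] R →ₐ[E] E ⊗[A] B :=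
    Algebra.TensorProduct.map (AlgHom.id E E) (IsScalarTower.toAlgHom A R B)
  let _ : Algebra (E ⊗[A] R) (E ⊗[A] B) := τ.toRingHom.toAlgebra
  have hτ : ∀ x, algebraMap (E ⊗[A] R) (E ⊗[A] B) x = τ x := fun _ ↦ rfl
  have : IsScalarTower E (E ⊗[A] R) (E ⊗[A] B) :=
    .of_algebraMap_eq fun e ↦ (τ.commutes e).symm
  have : IsScalarTower S (E ⊗[A] R) (E ⊗[A] B) :=
    .of_algebraMap_eq (R := S) (S := E ⊗[A] R) (A := E ⊗[A] B)
      fun s ↦ (τ.commutes (MvPowerSeries.C s)).symm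
  have : IsNoetherianRing (E ⊗[A] R) := IsNoetherianRing.of_finite E _
  let ψE : E ⊗[A] B →ₗ[E] E := (Algebra.linearMap A E ∘ₗ ψ).liftBaseChange E
  obtain ⟨K, hKfin, hK⟩ := exists_finite_quotient_of_linearMap (R' := E ⊗[A] R) ψE
  let ψR : R →ₗ[A] A := ψ ∘ₗ (IsScalarTower.toAlgHom A R B).toLinearMap
  have hψE : ∀ x : E ⊗[A] R, ψE (τ x) = (Algebra.linearMap A E ∘ₗ ψR).liftBaseChange E x := by
    intro x
    induction x with
    | zero => simp
    | add x y hx hy => rw [map_add, map_add, map_add, hx, hy]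
    | tmul e r => rfl
  obtain ⟨π₀, hπ₀⟩ := Algebra.TensorProduct.exists_ringHom_apply_tmul ev (algebraMap R S) hev
  let π : E ⊗[A] R →ₐ[S] S :=
    { π₀ with
      commutes' := fun s ↦ by
        change π₀ (MvPowerSeries.C s ⊗ₜ 1) = s
        rw [hπ₀, hevC, map_one, mul_one, RingHom.id_apply] }
  have hω : ∀ g : E ⊗[A] R, g ≠ 0 → g • K.mkQ (1 : E ⊗[A] B) ≠ 0 := by
    refine fun g hg h0 ↦ hg ?_
    rw [← map_smul, Submodule.mkQ_apply, Submodule.Quotient.mk_eq_zero] at h0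
    refine MvPowerSeries.eq_zero_of_forall_liftBaseChange_eq_zero ψR
      (ψ.eq_zero_of_forall_apply_smul_eq_zero hψ) g fun r ↦ ?_
    have h1 := hK _ h0 (1 ⊗ₜ r)
    rw [Algebra.smul_def, Algebra.smul_def, mul_one, hτ, hτ, ← map_mul τ] at h1
    rw [← hψE]
    exact h1
  obtain ⟨ρ, hρ⟩ := exists_forall_pow_notMem_map_pow p π K.mkQ hω c hc
  let G := (E ⊗[A] B) ⧸ (RingHom.ker π).map (algebraMap (E ⊗[A] R) (E ⊗[A] B))
  let β : B →+* G :=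
    (Ideal.Quotient.mk _).comp (Algebra.TensorProduct.includeRight : B →ₐ[A] E ⊗[A] B).toRingHom
  obtain ⟨Φ, hΦ⟩ := Algebra.TensorProduct.exists_ringHom_apply_tmul (algebraMap S G) β (by
    ext r
    refine (Ideal.Quotient.eq.mpr ?_).symm
    have h1 : (1 ⊗ₜ r - MvPowerSeries.C (algebraMap R S r) ⊗ₜ 1 : E ⊗[A] R) ∈
        RingHom.ker π := by
      rw [RingHom.mem_ker, map_sub, sub_eq_zero]
      change π₀ _ = π₀ _
      rw [hπ₀, hπ₀, hevC, map_one, map_one, one_mul, mul_one, RingHom.id_apply]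
    have h2 := Ideal.mem_map_of_mem (algebraMap (E ⊗[A] R) (E ⊗[A] B)) h1
    rw [hτ, map_sub] at h2
    simp only [τ, Algebra.TensorProduct.map_tmul, map_one] at h2
    exact h2)
  have h2 : Φ.comp (algebraMap S (S ⊗[R] B)) = algebraMap S G := by
    ext s
    exact (hΦ s 1).trans ((congrArg _ (map_one β)).trans (mul_one _))
  refine ⟨ρ, fun u Q huQ hmem ↦ hρ u Q huQ ?_⟩
  have h1 := Ideal.mem_map_of_mem Φ hmem
  rwa [Ideal.map_map, h2, ← RingHom.comp_apply, h2] at h1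

theorem Ideal.mem_map_algebraMap_pi {S D κ : Type*} [CommRing S] [CommRing D] [Algebra S D]
    {J : Ideal S} (hJ : J.FG) {x : κ → D} :
    x ∈ J.map (algebraMap S (κ → D)) ↔ ∀ n, x n ∈ J.map (algebraMap S D) := by
  refine ⟨fun h n ↦ ?_, fun h ↦ ?_⟩
  · have h1 := Ideal.mem_map_of_mem (Pi.evalRingHom (fun _ : κ ↦ D) n) h
    rwa [Ideal.map_map] at h1
  · obtain ⟨m, v, rfl⟩ := Submodule.fg_iff_exists_fin_generating_family.mp hJ
    have h1 : ∀ n, ∃ y : Fin m → D, ∑ i, y i * algebraMap S D (v i) = x n := fun n ↦ by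
      have := h n
      rwa [← Ideal.span, Ideal.map_span, ← Set.range_comp, Ideal.mem_span_range_iff_exists_fun]
        at this
    choose y hy using h1
    rw [← Ideal.span, Ideal.map_span, ← Set.range_comp, Ideal.mem_span_range_iff_exists_fun]
    exact ⟨fun i n ↦ y n i, funext fun n ↦ by rw [Finset.sum_apply, ← hy]; rfl⟩

theorem exists_isBalancedBigCM_of_colon {S : Type*} [CommRing S] [IsLocalRing S]
    [IsNoetherianRing S] (D : Type u) [CommRing D] [Algebra S D]
    (hD : (maximalIdeal S).map (algebraMap S D) ≠ ⊤)
    (hcolon : ∀ (n : ℕ) (w : Fin n → S), IsSOP S w → ∀ (a : Fin n → ℕ) (j : Fin n) (N : ℕ) (t : D),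
      algebraMap S D (w j ^ a j) * t ∈
        (Ideal.span ((fun i ↦ w i ^ a i) '' {i | i ≠ j})).map (algebraMap S D) →
      t ∈ (Ideal.span (Set.range fun i ↦ w i ^ Function.update a j N i)).map (algebraMap S D)) :
    ∃ (C : Type u) (_ : CommRing C) (_ : Algebra S C),
      IsBalancedBigCM S C ∧ Nonempty (D →ₐ[S] C) := by
  let 𝔑 : Ideal (ℕ → D) :=
    { carrier := {t | ∀ N, ∀ᶠ a in Filter.atTop,
        t a ∈ (maximalIdeal S ^ N).map (algebraMap S D)}
      add_mem' := fun hx hy N ↦ by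
        filter_upwards [hx N, hy N] with a h1 h2 using add_mem h1 h2
      zero_mem' := fun N ↦ .of_forall fun a ↦ zero_mem _
      smul_mem' := fun x t ht N ↦ by
        filter_upwards [ht N] with a h1 using Ideal.mul_mem_left _ _ h1 }
  let C := (ℕ → D) ⧸ 𝔑
  have hmem : ∀ (J : Ideal S) (t : ℕ → D),
      Ideal.Quotient.mk 𝔑 t ∈ J.map (algebraMap S C) →
      ∀ N, ∀ᶠ a in Filter.atTop, t a ∈ (J ⊔ maximalIdeal S ^ N).map (algebraMap S D) := by
    intro J t ht N
    have h1 : algebraMap S C = (Ideal.Quotient.mk 𝔑).comp (algebraMap S (ℕ → D)) := rfl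
    rw [h1, ← Ideal.map_map, Ideal.mem_map_iff_of_surjective _ Ideal.Quotient.mk_surjective] at ht
    obtain ⟨y, hy, hyt⟩ := ht
    have h2 := Ideal.Quotient.eq.mp hyt.symm
    filter_upwards [h2 N] with a ha
    rw [Ideal.map_sup, ← sub_add_cancel (t a) (y a), add_comm]
    exact Submodule.add_mem_sup ((Ideal.mem_map_algebraMap_pi (IsNoetherian.noetherian J)).mp hy a)
      ha
  have hmem' : ∀ (J : Ideal S) (t : ℕ → D),
      (∀ N, ∀ᶠ a in Filter.atTop, t a ∈ (J ⊔ maximalIdeal S ^ N).map (algebraMap S D)) →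
      Ideal.Quotient.mk 𝔑 t ∈ J.map (algebraMap S C) := by
    intro J t ht
    classical
    let P : ℕ → ℕ → Prop := fun a N ↦ t a ∈ (J ⊔ maximalIdeal S ^ N).map (algebraMap S D)
    have hP : ∀ a, P a (Nat.findGreatest (P a) a) := fun a ↦
      Nat.findGreatest_spec (m := 0) (Nat.zero_le a) (by
        simp only [P, pow_zero, Ideal.one_eq_top, sup_top_eq, Ideal.map_top]; trivial)
    have h1 : ∀ a, ∃ y ∈ J.map (algebraMap S D), t a - y ∈
        (maximalIdeal S ^ Nat.findGreatest (P a) a).map (algebraMap S D) := fun a ↦ by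
      have := hP a
      simp only [P] at this
      rw [Ideal.map_sup] at this
      obtain ⟨y, hy, z, hz, h⟩ := Submodule.mem_sup.mp this
      exact ⟨y, hy, by rwa [← h, add_sub_cancel_left]⟩
    choose y hy hty using h1
    have h2 : Ideal.Quotient.mk 𝔑 t = Ideal.Quotient.mk 𝔑 y := by
      refine Ideal.Quotient.eq.mpr fun N ↦ ?_
      filter_upwards [ht N, Filter.eventually_ge_atTop N] with a ha haN
      exact Ideal.map_mono (Ideal.pow_le_pow_right (Nat.le_findGreatest haN ha)) (hty a)
    have h3 := Ideal.mem_map_of_mem (Ideal.Quotient.mk 𝔑)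
      ((Ideal.mem_map_algebraMap_pi (IsNoetherian.noetherian J)).mpr hy)
    rw [Ideal.map_map] at h3
    rw [h2]
    exact h3
  have hC : (maximalIdeal S).map (algebraMap S C) ≠ ⊤ := by
    intro h
    obtain ⟨a, ha⟩ := (hmem (maximalIdeal S) 1 (by rw [h]; trivial) 1).exists
    rw [pow_one, sup_idem] at ha
    exact hD ((Ideal.eq_top_iff_one _).mpr ha)
  have hreg : ∀ (n : ℕ) (w : Fin n → S), IsSOP S w → ∀ (j : Fin n) (t : C),
      algebraMap S C (w j) * t ∈ (Ideal.span (w '' {i | i < j})).map (algebraMap S C) →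
      t ∈ (Ideal.span (w '' {i | i < j})).map (algebraMap S C) := by
    intro n w hw j t ht
    obtain ⟨t, rfl⟩ := Ideal.Quotient.mk_surjective t
    refine hmem' _ _ fun N ↦ ?_
    set J := Ideal.span (w '' {i | i < j})
    obtain ⟨M, hM⟩ := hw.exists_pow_le_span fun _ ↦ N + 1
    filter_upwards [hmem J (algebraMap S (ℕ → D) (w j) * t) ht M] with a ha
    let b : Fin n → ℕ := fun i ↦ if i ≤ j then 1 else N + 1
    have hle : J ⊔ maximalIdeal S ^ M ≤
        Ideal.span ((fun i ↦ w i ^ b i) '' {i | i ≠ j}) ⊔ Ideal.span {w j ^ (N + 1)} := by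
      refine sup_le (Ideal.span_le.mpr ?_) (hM.trans (Ideal.span_le.mpr ?_))
      · rintro _ ⟨i, hi, rfl⟩
        refine Ideal.mem_sup_left (Ideal.subset_span ⟨i, ne_of_lt hi, ?_⟩)
        simp [b, le_of_lt (show i < j from hi)]
      · rintro _ ⟨i, rfl⟩
        by_cases hij : i = j
        · subst hij
          exact Ideal.mem_sup_right (Ideal.mem_span_singleton_self _)
        · refine Ideal.mem_sup_left ?_
          refine Ideal.mem_of_dvd _ (pow_dvd_pow (w i) (?_ : b i ≤ N + 1))
            (Ideal.subset_span ⟨i, hij, rfl⟩)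
          simp only [b]; split_ifs <;> omega
    have h1 := Ideal.map_mono (f := algebraMap S D) hle ha
    rw [Ideal.map_sup, Ideal.map_span (algebraMap S D) {_}, Set.image_singleton] at h1
    obtain ⟨y, hy, z, hz, hyz⟩ := Submodule.mem_sup.mp h1
    obtain ⟨z, rfl⟩ := Ideal.mem_span_singleton'.mp hz
    have h2 := hcolon n w hw b j (N + 1) (t a - algebraMap S D (w j ^ N) * z) (by
      convert hy using 1
      simp only [b, le_refl, if_true, pow_one, mul_sub]
      rw [sub_eq_iff_eq_add, ← mul_assoc, ← map_mul, ← pow_succ', mul_comm _ z]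
      exact hyz.symm)
    have hle2 : Ideal.span (Set.range fun i ↦ w i ^ Function.update b j (N + 1) i) ≤
        J ⊔ maximalIdeal S ^ N := by
      refine Ideal.span_le.mpr ?_
      rintro _ ⟨i, rfl⟩
      by_cases hij : i < j
      · refine Ideal.mem_sup_left ?_
        simp only [Function.update_of_ne hij.ne, b, if_pos hij.le, pow_one]
        exact Ideal.subset_span ⟨i, hij, rfl⟩
      · refine Ideal.mem_sup_right (Ideal.pow_le_pow_right (?_ : N ≤ N + 1) ?_)
        · omega
        · convert Ideal.pow_mem_pow (hw.2.1 i) (N + 1)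
          by_cases h : i = j
          · subst h; simp
          · rw [Function.update_of_ne h]
            exact if_neg fun h' ↦ hij (lt_of_le_of_ne h' h)
    rw [← sub_add_cancel (t a) (algebraMap S D (w j ^ N) * z)]
    refine add_mem (Ideal.map_mono hle2 h2) (Ideal.mul_mem_right _ _ (Ideal.mem_map_of_mem _ ?_))
    exact Ideal.mem_sup_right (Ideal.pow_mem_pow (hw.2.1 j) N)
  refine ⟨C, inferInstance, inferInstance, ⟨fun n w hw ↦ ⟨?_, ?_⟩, hC⟩,
    ⟨(Ideal.Quotient.mkₐ S 𝔑).comp (Pi.constAlgHom S ℕ D)⟩⟩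
  · rw [RingTheory.Sequence.isWeaklyRegular_iff_Fin]
    intro j
    have hj : (j : ℕ) < n := by simpa using j.2
    have h1 : Ideal.ofList ((List.ofFn w).take j) = Ideal.span (w '' {i | i < ⟨j, hj⟩}) := by
      refine congrArg Ideal.span (Set.ext fun x ↦ ?_)
      rw [Set.mem_ofPred_eq, List.mem_take_iff_getElem]
      constructor
      · rintro ⟨i, hi, rfl⟩
        exact ⟨⟨i, by omega⟩, Fin.mk_lt_mk.mpr (by omega), by rw [List.getElem_ofFn]⟩
      · rintro ⟨i, hi, rfl⟩
        have hi' : (i : ℕ) < j := hi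
        exact ⟨i, by omega, by rw [List.getElem_ofFn]⟩
    rw [h1, isSMulRegular_quotient_iff_mem_of_smul_mem, Ideal.smul_top_eq_map]
    intro t ht
    refine hreg n w hw ⟨j, hj⟩ t ?_
    rw [Algebra.smul_def] at ht
    simpa using ht
  · intro h
    rw [Ideal.smul_top_eq_map] at h
    have h1 : (1 : C) ∈ (Ideal.ofList (List.ofFn w)).map (algebraMap S C) :=
      (Submodule.restrictScalars_mem S _ _).mp (h.le Submodule.mem_top)
    refine hC ((Ideal.eq_top_iff_one _).mpr (Ideal.map_mono (Ideal.span_le.mpr ?_) h1))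
    intro x hx
    obtain ⟨i, rfl⟩ := List.mem_ofFn.mp hx
    exact hw.2.1 i

theorem exists_colon_of_monoidHom {S : Type*} [CommRing S] [IsDomain S] [IsLocalRing S]
    [IsNoetherianRing S] (G : Type u) [CommRing G] [Algebra S G] (r : ℕ → S →* G)
    (hr : ∀ c ≠ 0, ∃ e, r e c ∉ (maximalIdeal S).map (algebraMap S G))
    (hcolon : ∀ (n : ℕ) (w : Fin n → S), IsSOP S w →
      ∃ c ≠ 0, ∀ (a : Fin n → ℕ) (j : Fin n) (t : G), algebraMap S G (w j ^ a j) * t ∈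
        (Ideal.span ((fun i ↦ w i ^ a i) '' {i | i ≠ j})).map (algebraMap S G) → ∀ e N, r e c * t ∈
          (Ideal.span (Set.range fun i ↦ w i ^ Function.update a j N i)).map (algebraMap S G)) :
    ∃ (D : Type u) (_ : CommRing D) (_ : Algebra S D),
      (maximalIdeal S).map (algebraMap S D) ≠ ⊤ ∧ Nonempty (G →ₐ[S] D) ∧
      ∀ (n : ℕ) (w : Fin n → S), IsSOP S w → ∀ (a : Fin n → ℕ) (j : Fin n) (N : ℕ) (t : D),
        algebraMap S D (w j ^ a j) * t ∈
          (Ideal.span ((fun i ↦ w i ^ a i) '' {i | i ≠ j})).map (algebraMap S D) →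
        t ∈ (Ideal.span (Set.range fun i ↦ w i ^ Function.update a j N i)).map
          (algebraMap S D) := by
  let γ : S →* (ℕ → G) := MonoidHom.pi r
  let Γ : Submonoid (ℕ → G) := (nonZeroDivisors S).map γ
  let D := Localization Γ
  have hD : ∀ (J : Ideal S) (x : ℕ → G), algebraMap (ℕ → G) D x ∈ J.map (algebraMap S D) ↔
      ∃ c ≠ 0, ∀ e, r e c * x e ∈ J.map (algebraMap S G) := by
    intro J x
    rw [IsScalarTower.algebraMap_eq S (ℕ → G) D, ← Ideal.map_map,
      IsLocalization.algebraMap_mem_map_algebraMap_iff Γ]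
    constructor
    · rintro ⟨_, ⟨c, hc, rfl⟩, h⟩
      exact ⟨c, nonZeroDivisors.ne_zero hc,
        (Ideal.mem_map_algebraMap_pi (IsNoetherian.noetherian J)).mp h⟩
    · rintro ⟨c, hc, h⟩
      exact ⟨γ c, ⟨c, mem_nonZeroDivisors_of_ne_zero hc, rfl⟩,
        (Ideal.mem_map_algebraMap_pi (IsNoetherian.noetherian J)).mpr h⟩
  refine ⟨D, inferInstance, inferInstance, fun h ↦ ?_,
    ⟨(IsScalarTower.toAlgHom S (ℕ → G) D).comp (Pi.constAlgHom S ℕ G)⟩, ?_⟩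
  · obtain ⟨c, hc, h1⟩ := (hD (maximalIdeal S) 1).mp (by rw [h]; trivial)
    obtain ⟨e, he⟩ := hr c hc
    exact he (by simpa using h1 e)
  · intro n w hw a j N t ht
    obtain ⟨c, hc, h⟩ := hcolon n w hw
    obtain ⟨⟨x, m⟩, hx⟩ := IsLocalization.surj Γ t
    have hm : IsUnit (algebraMap (ℕ → G) D m) := IsLocalization.map_units D m
    rw [← Ideal.mul_unit_mem_iff_mem _ hm] at ht ⊢
    rw [mul_assoc, hx, IsScalarTower.algebraMap_apply S (ℕ → G) D, ← map_mul, hD] at ht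
    rw [hx, hD]
    obtain ⟨c', hc', h'⟩ := ht
    refine ⟨c * c', mul_ne_zero hc hc', fun e ↦ ?_⟩
    rw [map_mul, mul_assoc]
    refine h a j _ ?_ e N
    rw [mul_left_comm]
    exact h' e

theorem Ideal.pow_expChar_pow_pow_mem_span {U κ : Type*} [CommRing U] (p : ℕ) [ExpChar U p]
    {f : κ → U} {s : Set κ} {n : ℕ} {x : U} (hx : x ∈ Ideal.span ((fun i ↦ f i ^ p ^ n) '' s))
    (m : ℕ) : x ^ p ^ m ∈ Ideal.span ((fun i ↦ f i ^ p ^ (n + m)) '' s) := by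
  simpa only [← pow_mul, ← pow_add] using Ideal.pow_expChar_pow_mem_span p hx m

namespace IsPRadical

theorem exists_pow_eq_pow_of_apply_eq {G P : Type*} [CommRing G] [CommRing P] (φ : G →+* P) (p : ℕ)
    [ExpChar G p] [IsPRadical φ p] {g h : G} (hgh : φ g = φ h) : ∃ n, g ^ p ^ n = h ^ p ^ n := by
  have h1 : g - h ∈ RingHom.ker φ := by rw [RingHom.mem_ker, map_sub, hgh, sub_self]
  obtain ⟨n, hn⟩ := mem_pNilradical.mp (ker_le φ p h1)
  exact ⟨n, by rwa [sub_pow_expChar_pow, sub_eq_zero] at hn⟩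

theorem exists_pow_eq_apply_of_mem_span {G P κ : Type*} [CommRing G] [CommRing P] (φ : G →+* P)
    (p : ℕ) [ExpChar G p] [ExpChar P p] [IsPRadical φ p] {f : κ → G} {s : Set κ} {t : P}
    (ht : t ∈ Ideal.span ((fun i ↦ φ (f i)) '' s)) :
    ∃ n, ∃ h ∈ Ideal.span ((fun i ↦ f i ^ p ^ n) '' s), t ^ p ^ n = φ h := by
  induction ht using Submodule.span_induction with
  | mem x hx =>
    obtain ⟨i, hi, rfl⟩ := hx
    refine ⟨0, f i, Ideal.subset_span ⟨i, hi, ?_⟩, ?_⟩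
    · beta_reduce; rw [pow_zero, pow_one]
    · beta_reduce; rw [pow_zero, pow_one]
  | zero => exact ⟨0, 0, zero_mem _, by rw [pow_zero, pow_one, map_zero]⟩
  | add x y _ _ hx hy =>
    obtain ⟨n, g, hg, hgx⟩ := hx
    obtain ⟨m, h, hh, hhy⟩ := hy
    refine ⟨n + m, g ^ p ^ m + h ^ p ^ n,
      add_mem (Ideal.pow_expChar_pow_pow_mem_span p hg m) ?_, ?_⟩
    · rw [add_comm n]; exact Ideal.pow_expChar_pow_pow_mem_span p hh n
    · rw [add_pow_expChar_pow, map_add, map_pow, map_pow, ← hgx, ← hhy, ← pow_mul, ← pow_mul,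
        ← pow_add, ← pow_add, add_comm m]
  | smul c x _ hx =>
    obtain ⟨n, g, hg, hgx⟩ := hx
    obtain ⟨m, h, hhc⟩ := IsPRadical.pow_mem φ p c
    refine ⟨n + m, h ^ p ^ n * g ^ p ^ m,
      Ideal.mul_mem_left _ _ (Ideal.pow_expChar_pow_pow_mem_span p hg m), ?_⟩
    rw [smul_eq_mul, mul_pow, map_mul, map_pow, map_pow, ← hgx, hhc, ← pow_mul, ← pow_mul,
        ← pow_add, ← pow_add, add_comm m]

theorem exists_pow_mem_span {G P κ : Type*} [CommRing G] [CommRing P] (φ : G →+* P) (p : ℕ)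
    [ExpChar G p] [ExpChar P p] [IsPRadical φ p] {f : κ → G} {s : Set κ} {g : G}
    (hg : φ g ∈ Ideal.span ((fun i ↦ φ (f i)) '' s)) :
    ∃ n, g ^ p ^ n ∈ Ideal.span ((fun i ↦ f i ^ p ^ n) '' s) := by
  obtain ⟨n, h, hh, hgh⟩ := exists_pow_eq_apply_of_mem_span φ p hg
  rw [← map_pow] at hgh
  obtain ⟨m, hm⟩ := exists_pow_eq_pow_of_apply_eq φ p hgh
  refine ⟨n + m, ?_⟩
  rw [pow_add, pow_mul, hm, ← pow_add]
  exact Ideal.pow_expChar_pow_pow_mem_span p hh m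

theorem exists_pow_eq_and_mul_mem_span {G P κ : Type*} [CommRing G] [CommRing P] (φ : G →+* P)
    (p : ℕ) [ExpChar G p] [ExpChar P p] [IsPRadical φ p] {f : κ → G} {s : Set κ} {g : G} {t : P}
    (ht : φ g * t ∈ Ideal.span ((fun i ↦ φ (f i)) '' s)) :
    ∃ n h, t ^ p ^ n = φ h ∧ g ^ p ^ n * h ∈ Ideal.span ((fun i ↦ f i ^ p ^ n) '' s) := by
  obtain ⟨m, x, hx⟩ := pow_mem φ p t
  have h1 := Ideal.pow_expChar_pow_mem_span p ht m
  rw [mul_pow, ← hx, ← map_pow, ← map_mul] at h1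
  simp only [← map_pow] at h1
  obtain ⟨n, hn⟩ := exists_pow_mem_span φ p h1
  simp only [mul_pow, ← pow_mul, ← pow_add] at hn
  refine ⟨m + n, x ^ p ^ n, ?_, hn⟩
  rw [map_pow, hx, ← pow_mul, pow_add]

end IsPRadical

theorem Ideal.mem_span_of_pow_mem_span_pow {C : Type*} [CommRing C] (p : ℕ)
    [ExpChar C p] [PerfectRing C p] {κ : Type*} {f : κ → C} {s : Set κ} {t : C} {e : ℕ}
    (h : t ^ p ^ e ∈ Ideal.span ((fun i ↦ f i ^ p ^ e) '' s)) : t ∈ Ideal.span (f '' s) := by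
  have h1 := Ideal.mem_map_of_mem (iterateFrobeniusEquiv C p e).symm h
  rw [Ideal.map_span, Set.image_image] at h1
  simp only [← iterateFrobeniusEquiv_def] at h1
  simpa only [RingEquiv.symm_apply_apply] using h1

theorem exists_colon_of_frobenius {S : Type*} [CommRing S] [IsDomain S] [IsLocalRing S]
    [IsNoetherianRing S] (G : Type u) [CommRing G] [Algebra S G] (p : ℕ) [Fact p.Prime] [CharP G p]
    (hG : ∀ c : S, c ≠ 0 → ∃ ρ : ℕ, ∀ u Q : ℕ, ρ * u < Q →
      algebraMap S G (c ^ u) ∉ (maximalIdeal S ^ Q).map (algebraMap S G))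
    (hcolon : ∀ (n : ℕ) (w : Fin n → S), IsSOP S w →
      ∃ c : S, c ≠ 0 ∧ ∃ e₀ : ℕ, ∀ (a : Fin n → ℕ) (j : Fin n) (t : G),
        algebraMap S G (w j) ^ a j * t ∈
          Ideal.span ((fun i ↦ algebraMap S G (w i) ^ a i) '' {i | i ≠ j}) →
        ∀ e ≥ e₀, ∀ N : ℕ, algebraMap S G c * t ^ p ^ e ∈
          (Ideal.span (Set.range fun i ↦ w i ^ Function.update (fun i ↦ p ^ e * a i) j N i)).map
            (algebraMap S G)) :
    ∃ (D : Type u) (_ : CommRing D) (_ : Algebra S D),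
      (maximalIdeal S).map (algebraMap S D) ≠ ⊤ ∧ Nonempty (G →ₐ[S] D) ∧
      ∀ (n : ℕ) (w : Fin n → S), IsSOP S w → ∀ (a : Fin n → ℕ) (j : Fin n) (N : ℕ) (t : D),
        algebraMap S D (w j ^ a j) * t ∈
          (Ideal.span ((fun i ↦ w i ^ a i) '' {i | i ≠ j})).map (algebraMap S D) →
        t ∈ (Ideal.span (Set.range fun i ↦ w i ^ Function.update a j N i)).map
          (algebraMap S D) := by
  let P := PerfectClosure G p
  let φ : G →+* P := PerfectClosure.of G p
  let _ : Algebra S P := (φ.comp (algebraMap S G)).toAlgebra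
  have hφ : ∀ s, algebraMap S P s = φ (algebraMap S G s) := fun _ ↦ rfl
  let r : ℕ → S →* P := fun e ↦
    ((iterateFrobeniusEquiv P p e).symm : P →* P).comp (algebraMap S P : S →* P)
  have hr : ∀ e c, r e c ^ p ^ e = φ (algebraMap S G c) := fun e c ↦ by
    rw [← iterateFrobeniusEquiv_def]
    exact (iterateFrobeniusEquiv P p e).apply_symm_apply _
  have h1 : ∀ c ≠ 0, ∃ e, r e c ∉ (maximalIdeal S).map (algebraMap S P) := by
    intro c hc
    obtain ⟨ρ, hρ⟩ := hG c hc
    obtain ⟨e, he⟩ : ∃ e, ρ < p ^ e := ⟨ρ, Nat.lt_pow_self (Fact.out : p.Prime).one_lt⟩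
    refine ⟨e, fun hmem ↦ ?_⟩
    have h1 := Ideal.pow_expChar_pow_mem_span p (f := algebraMap S P) hmem e
    rw [hr] at h1
    simp only [hφ, ← map_pow φ] at h1
    obtain ⟨n, hn⟩ := IsPRadical.exists_pow_mem_span φ p h1
    rw [← map_pow] at hn
    refine hρ (p ^ n) (p ^ (e + n)) ?_ (Ideal.span_le.mpr ?_ hn)
    · rw [pow_add]
      exact mul_lt_mul_of_pos_right he (pow_pos (Fact.out : p.Prime).pos n)
    · rintro _ ⟨x, hx, rfl⟩
      change (algebraMap S G x ^ p ^ e) ^ p ^ n ∈ _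
      rw [← pow_mul, ← pow_add, ← map_pow]
      exact Ideal.mem_map_of_mem _ (Ideal.pow_mem_pow hx _)
  have h2 : ∀ (n : ℕ) (w : Fin n → S), IsSOP S w →
      ∃ c ≠ 0, ∀ (a : Fin n → ℕ) (j : Fin n) (t : P), algebraMap S P (w j ^ a j) * t ∈
        (Ideal.span ((fun i ↦ w i ^ a i) '' {i | i ≠ j})).map (algebraMap S P) → ∀ e N, r e c * t ∈
          (Ideal.span (Set.range fun i ↦ w i ^ Function.update a j N i)).map (algebraMap S P) := by
    intro n w hw
    obtain ⟨c, hc, e₀, h⟩ := hcolon n w hw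
    refine ⟨c, hc, fun a j t ht e N ↦ ?_⟩
    rw [Ideal.map_span, Set.image_image, hφ] at ht
    simp only [hφ] at ht
    obtain ⟨m, x, hx, hxm⟩ := IsPRadical.exists_pow_eq_and_mul_mem_span φ p ht
    simp only [map_pow, ← pow_mul, mul_comm _ (p ^ m)] at hxm
    have h1 := Ideal.mem_map_of_mem φ
      (h (fun i ↦ p ^ m * a i) j x hxm (e + e₀) (Nat.le_add_left _ _) (p ^ (e + e₀ + m) * N))
    rw [Ideal.map_map, map_mul, map_pow, ← hx] at h1
    have h2 : ∀ i, Function.update (fun i ↦ p ^ (e + e₀) * (p ^ m * a i)) j (p ^ (e + e₀ + m) * N) i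
        = Function.update a j N i * p ^ (e + (e₀ + m)) := by
      intro i
      by_cases hij : i = j
      · subst hij; simp [mul_comm, add_assoc]
      · simp only [Function.update_of_ne hij]; ring
    simp only [h2] at h1
    have h3 : (r (e + (e₀ + m)) c * t) ^ p ^ (e + (e₀ + m)) ∈ Ideal.span
        ((fun i ↦ algebraMap S P (w i ^ Function.update a j N i) ^ p ^ (e + (e₀ + m))) ''
          Set.univ) := by
      rw [mul_pow, hr]
      rw [← pow_mul, ← pow_add, Ideal.map_span, ← Set.range_comp, add_comm m, add_assoc] at h1
      rw [Set.image_univ]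
      convert h1 using 4 with i
      rw [← map_pow, ← pow_mul]; rfl
    have h4 := Ideal.mem_span_of_pow_mem_span_pow p h3
    have h5 : r e c = r (e + (e₀ + m)) c ^ p ^ (e₀ + m) := by
      apply (iterateFrobeniusEquiv P p e).injective
      rw [iterateFrobeniusEquiv_def, iterateFrobeniusEquiv_def, hr, ← pow_mul, ← pow_add,
        add_comm _ e, hr]
    have h6 : p ^ (e₀ + m) ≠ 0 := pow_ne_zero _ (Fact.out : p.Prime).ne_zero
    rw [h5, ← pow_sub_one_mul h6, mul_assoc, Ideal.map_span, ← Set.range_comp, ← Set.image_univ]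
    exact Ideal.mul_mem_left _ _ h4
  obtain ⟨D, _, _, hD, ⟨ι⟩, h⟩ := exists_colon_of_monoidHom P r h1 h2
  exact ⟨D, _, _, hD, ⟨ι.comp { φ with commutes' := fun _ ↦ rfl }⟩, h⟩

theorem exists_isBalancedBigCM_of_finite {ι k R : Type*} {B S : Type u} [Field k] [Fintype ι]
    [CommRing R] [IsDomain R] [Algebra (MvPowerSeries ι k) R] [Module.Finite (MvPowerSeries ι k) R]
    [CommRing B] [Algebra (MvPowerSeries ι k) B] [Algebra R B]
    [IsScalarTower (MvPowerSeries ι k) R B] [CommRing S] [IsDomain S] [IsLocalRing S]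
    [IsNoetherianRing S] [IsAdicComplete (maximalIdeal S) S] (p : ℕ) [Fact p.Prime] [CharP S p]
    [Algebra R S]
    (hl : ∀ i, algebraMap R S (algebraMap (MvPowerSeries ι k) R (.X i)) ∈ maximalIdeal S)
    (hy : MonReg fun i : ι ↦ algebraMap (MvPowerSeries ι k) B (.X i))
    (h1 : 1 ∉ Ideal.span (Set.range fun i : ι ↦ algebraMap (MvPowerSeries ι k) B (.X i))) :
    ∃ (C : Type u) (_ : CommRing C) (_ : Algebra S C), IsBalancedBigCM S C ∧
      ∃ f : B →+* C, f.comp (algebraMap R B) = (algebraMap S C).comp (algebraMap R S) := by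
  let A := MvPowerSeries ι k
  let _ : Algebra A S := ((algebraMap R S).comp (algebraMap A R)).toAlgebra
  have : IsScalarTower A R S := .of_algebraMap_eq fun _ ↦ rfl
  let _ : Algebra k S :=
    (((algebraMap R S).comp (algebraMap A R)).comp (MvPowerSeries.C : k →+* A)).toAlgebra
  obtain ⟨ψ, hψ⟩ := hy.exists_functional h1
  have H := exists_forall_pow_notMem_map_pow_tensorProduct (S := S) p (fun _ ↦ rfl) hl ψ hψ
  let T := S ⊗[A] R
  let U := S ⊗[A] B
  let τ : T →ₐ[S] U := Algebra.TensorProduct.map (AlgHom.id S S) (IsScalarTower.toAlgHom A R B)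
  have hτ : ∀ s r, τ (s ⊗ₜ r) = s ⊗ₜ algebraMap R B r := fun _ _ ↦ rfl
  let π : T →ₐ[S] S := Algebra.TensorProduct.lift (Algebra.ofId S S) (IsScalarTower.toAlgHom A R S)
    fun _ _ ↦ mul_comm _ _
  let G := U ⧸ (RingHom.ker π).map τ
  have hT : IsNoetherianRing T := IsNoetherianRing.of_finite S T
  have hπ : (RingHom.ker π).IsPrime := RingHom.ker_isPrime π
  obtain ⟨c, hcπ, M, hc⟩ := Ideal.exists_notMem_mul_pow_eq_zero (S := S) (RingHom.ker π) (by
    ext s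
    rw [Ideal.mem_comap, RingHom.mem_ker, π.commutes]
    rfl)
  let Θ : U →ₐ[S] S ⊗[R] B := Algebra.TensorProduct.lift (Algebra.ofId S _)
    ((Algebra.TensorProduct.includeRight : B →ₐ[R] S ⊗[R] B).restrictScalars A)
    fun _ _ ↦ mul_comm _ _
  have hΘ : Θ.comp τ = (Algebra.ofId S _).comp π := by
    refine Algebra.TensorProduct.ext' fun s r ↦ ?_
    change Θ (τ (s ⊗ₜ r)) = algebraMap S (S ⊗[R] B) (π (s ⊗ₜ r))
    change (s ⊗ₜ[R] (1 : B)) * ((1 : S) ⊗ₜ[R] algebraMap R B r) = (s * algebraMap R S r) ⊗ₜ[R] 1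
    rw [Algebra.TensorProduct.tmul_mul_tmul, mul_one, one_mul, Algebra.algebraMap_eq_smul_one,
      tmul_smul, smul_tmul', Algebra.smul_def, mul_comm]
  let Φ : G →ₐ[S] S ⊗[R] B := Ideal.Quotient.liftₐ _ Θ fun x hx ↦ by
    have : (RingHom.ker π).map τ ≤ RingHom.ker Θ := by
      rw [Ideal.map_le_iff_le_comap]
      intro t ht
      rw [Ideal.mem_comap, RingHom.mem_ker, ← AlgHom.comp_apply, hΘ, AlgHom.comp_apply,
        (RingHom.mem_ker).mp ht, map_zero]
    exact this hx
  have hG : ∀ c : S, c ≠ 0 → ∃ ρ : ℕ, ∀ u Q : ℕ, ρ * u < Q →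
      algebraMap S G (c ^ u) ∉ (maximalIdeal S ^ Q).map (algebraMap S G) := by
    intro c hc
    obtain ⟨ρ, hρ⟩ := H c hc
    refine ⟨ρ, fun u Q huQ hmem ↦ hρ u Q huQ ?_⟩
    have h2 := Ideal.mem_map_of_mem (Φ : G →+* S ⊗[R] B) hmem
    rwa [Ideal.map_map, Φ.comp_algebraMap, RingHom.coe_coe, Φ.commutes] at h2
  have : Nontrivial G := by
    by_contra! h
    obtain ⟨ρ, hρ⟩ := hG 1 one_ne_zero
    exact hρ 0 1 (by simp) (by rw [Subsingleton.elim (algebraMap S G _) 0]; exact zero_mem _)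
  have : CharP G p := CharP.of_ringHom_of_ne_zero (algebraMap S G) p (Fact.out : p.Prime).ne_zero
  have : Nontrivial U := (Ideal.Quotient.mk ((RingHom.ker π).map τ)).domain_nontrivial
  have : CharP U p := CharP.of_ringHom_of_ne_zero (algebraMap S U) p (Fact.out : p.Prime).ne_zero
  obtain ⟨D, _, _, hD, ⟨δ⟩, hcolon⟩ := exists_colon_of_frobenius G p hG fun n w hw ↦ by
    obtain ⟨d, hd, h⟩ := hy.exists_smul_mem_span_pow_update p hl hw
    exact ⟨d * π c, mul_ne_zero hd hcπ, exists_forall_mul_pow_mem_map_quotient p τ π hc h⟩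
  obtain ⟨C, _, _, hC, ⟨γ⟩⟩ := exists_isBalancedBigCM_of_colon D hD hcolon
  let q : U →ₐ[S] G := Ideal.Quotient.mkₐ S _
  have hq : ∀ r : R, q (1 ⊗ₜ algebraMap R B r) = algebraMap S G (algebraMap R S r) := by
    intro r
    have h2 : (1 ⊗ₜ r - algebraMap R S r ⊗ₜ 1 : T) ∈ RingHom.ker π := by
      rw [RingHom.mem_ker, map_sub, sub_eq_zero]
      change 1 * algebraMap R S r = algebraMap R S r * algebraMap R S 1
      rw [map_one, one_mul, mul_one]
    have h3 := Ideal.mem_map_of_mem τ h2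
    rw [map_sub, hτ, hτ, map_one] at h3
    exact Ideal.Quotient.eq.mpr h3
  refine ⟨C, _, _, hC, ((γ.comp (δ.comp q)).toRingHom.comp
    (Algebra.TensorProduct.includeRight : B →ₐ[A] U).toRingHom), ?_⟩
  ext r
  change γ (δ (q (1 ⊗ₜ algebraMap R B r))) = _
  rw [hq, δ.commutes, γ.commutes]
  rfl

theorem IsBigCM.exists_isBalancedBigCM {R S B : Type u} [CommRing R] [IsDomain R] [IsLocalRing R]
    [IsNoetherianRing R] [IsAdicComplete (maximalIdeal R) R] [CommRing S] [IsDomain S]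
    [IsLocalRing S] [IsNoetherianRing S] [IsAdicComplete (maximalIdeal S) S] (p : ℕ)
    [Fact p.Prime] [CharP R p] [CharP S p] [Algebra R S] [IsLocalHom (algebraMap R S)]
    [CommRing B] [Algebra R B] (hB : IsBigCM R B) :
    ∃ (C : Type u) (_ : CommRing C) (_ : Algebra S C), IsBalancedBigCM S C ∧
      ∃ f : B →+* C, f.comp (algebraMap R B) = (algebraMap S C).comp (algebraMap R S) := by
  obtain ⟨⟨n, x, hx, hreg⟩, hm⟩ := hB
  obtain ⟨s, hs⟩ := exists_coefficient_field p R
  obtain ⟨g, hfin, -, hgX, -⟩ := hx.exists_finite_injective s hs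
  let A := MvPowerSeries (Fin n) (ResidueField R)
  let _ : Algebra A R := g.toAlgebra
  let _ : Algebra A B := ((algebraMap R B).comp g).toAlgebra
  have : IsScalarTower A R B := .of_algebraMap_eq fun _ ↦ rfl
  have : Module.Finite A R := hfin
  have hX : (fun i ↦ algebraMap A B (.X i)) = fun i ↦ algebraMap R B (x i) := by
    ext i
    rw [IsScalarTower.algebraMap_apply A R B, ← hgX]
    rfl
  refine exists_isBalancedBigCM_of_finite (k := ResidueField R) (ι := Fin n) p (fun i ↦ ?_) ?_ ?_
  · change algebraMap R S (g _) ∈ _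
    rw [hgX]
    exact (map_mem_nonunits_iff (algebraMap R S) _).mpr (hx.2.1 i)
  · rw [hX]
    refine MonReg.of_isWeaklyRegular _ ?_
    have := (RingTheory.Sequence.isWeaklyRegular_map_algebraMap_iff B B _).mpr
      hreg.toIsWeaklyRegular
    rwa [List.map_ofFn] at this
  · rw [hX]
    intro h1
    refine hm ((Ideal.eq_top_iff_one _).mpr (Ideal.span_le.mpr ?_ h1))
    rintro _ ⟨i, rfl⟩
    exact Ideal.mem_map_of_mem _ (hx.2.1 i)

/-- **Theorem (Dietz, Thm. 8.10 / `basechange`).** Let `R → S` be a local homomorphism of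
complete Noetherian local domains of positive prime characteristic `p`. If `T` is a seed
over `R`, then `T ⊗_R S` is a seed over `S`. Consequently, every big Cohen-Macaulay
`R`-algebra `B` maps to a balanced big Cohen-Macaulay `S`-algebra `C` compatibly with
`R → S`. -/
theorem seed_base_change
    (R : Type u) [CommRing R] [IsDomain R] [IsLocalRing R] [IsNoetherianRing R]
    [IsAdicComplete (maximalIdeal R) R]
    (S : Type u) [CommRing S] [IsDomain S] [IsLocalRing S] [IsNoetherianRing S]
    [IsAdicComplete (maximalIdeal S) S]
    (p : ℕ) [Fact p.Prime] [CharP R p] [CharP S p]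
    [Algebra R S] [IsLocalHom (algebraMap R S)]
    (T : Type u) [CommRing T] [Algebra R T] :
    (IsSeed R T → IsSeed S (TensorProduct R S T)) ∧
    (∀ (B : Type u) (_ : CommRing B) (_ : Algebra R B), IsBigCM R B →
      ∃ (C : Type u) (_ : CommRing C) (_ : Algebra S C),
        IsBalancedBigCM S C ∧
          ∃ f : B →+* C,
            f.comp (algebraMap R B) = (algebraMap S C).comp (algebraMap R S)) := by
  refine ⟨fun ⟨B, _, _, hB, ⟨φ⟩⟩ ↦ ?_, fun B _ _ hB ↦ hB.exists_isBalancedBigCM p⟩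
  obtain ⟨C, _, _, hC, f, hf⟩ := hB.exists_isBalancedBigCM (S := S) p
  obtain ⟨n, w, hw⟩ := exists_isSOP S
  obtain ⟨Φ, hΦ⟩ := Algebra.TensorProduct.exists_ringHom_apply_tmul (algebraMap S C)
    (f.comp (φ : T →+* B)) (by rw [RingHom.comp_assoc, φ.comp_algebraMap, hf])
  refine ⟨C, _, _, ⟨⟨n, w, hw, hC.1 n w hw⟩, hC.2⟩, ⟨{ Φ with commutes' := fun s ↦ ?_ }⟩⟩
  change Φ (s ⊗ₜ 1) = _
  rw [hΦ, map_one, mul_one]
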